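/- arXiv:1908.08725 — 9 statements merged into one kernel-verified Lean document; each statement's English description precedes it below -/
import Mathlib

section
/- Let A be an n×n real symmetric matrix with Gauss–Borel decomposition A = L⁻¹·U, where L is lower triangular with unit diagonal and U is upper triangular with nonzero diagonal entries, and let h be the diagonal matrix with the same diagonal as U. Then for every n×n real matrix Λ, setting L₁ = L·Λ·L⁻¹ and L₂ = U·Λᵀ·U⁻¹, one has L₁ = h·L₂ᵀ·h⁻¹. -/
open Matrix

/-- The diagonal of a product of upper triangular matrices is the product of the diagonals. -/
theorem Matrix.BlockTriangular.mul_apply_diag {ι R : Type*} [Fintype ι] [LinearOrder ι]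
    [NonUnitalNonAssocSemiring R] {M N : Matrix ι ι R} (hM : M.BlockTriangular id)
    (hN : N.BlockTriangular id) (i : ι) : (M * N) i i = M i i * N i i := by
  rw [Matrix.mul_apply]
  refine Finset.sum_eq_single i (fun j _ hj => ?_) (by simp)
  rcases lt_or_gt_of_ne hj with h | h
  · rw [hM h, zero_mul]
  · rw [hN h, mul_zero]

/-- A symmetric upper triangular matrix is diagonal. -/
theorem Matrix.BlockTriangular.eq_diagonal_of_isSymm {ι R : Type*} [LinearOrder ι] [Zero R]
    {M : Matrix ι ι R} (hM : M.BlockTriangular id) (hs : M.IsSymm) :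
    M = Matrix.diagonal M.diag := by
  ext i j
  rcases lt_trichotomy i j with h | rfl | h
  · rw [Matrix.diagonal_apply_ne _ h.ne, ← hs.apply i j, hM h]
  · simp
  · rw [Matrix.diagonal_apply_ne _ h.ne', hM h]

/-- For an n×n real symmetric matrix `A` with Gauss–Borel decomposition
`A = L⁻¹ * U` (`L` unit lower triangular, `U` upper triangular with nonzero diagonal) and
`h` the diagonal matrix with the diagonal of `U`, for every matrix `Λ`, setting
`L₁ = L * Λ * L⁻¹` and `L₂ = U * Λᵀ * U⁻¹`, one has `L₁ = h * L₂ᵀ * h⁻¹`. -/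
theorem stmt1 {n : ℕ} (A L U : Matrix (Fin n) (Fin n) ℝ)
    (hA : A.IsSymm)
    (hL_lower : ∀ i j : Fin n, i < j → L i j = 0)
    (hL_diag : ∀ i, L i i = 1)
    (hU_upper : ∀ i j : Fin n, j < i → U i j = 0)
    (hU_diag : ∀ i, U i i ≠ 0)
    (hLU : A = L⁻¹ * U) :
    ∀ Λ : Matrix (Fin n) (Fin n) ℝ,
      L * Λ * L⁻¹ =
        Matrix.diagonal (fun i => U i i) * (U * Λᵀ * U⁻¹)ᵀ *
          (Matrix.diagonal (fun i => U i i))⁻¹ := by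
  have hLt : Lᵀ.BlockTriangular id := fun i j h => hL_lower j i h
  have hUt : U.BlockTriangular id := fun i j h => hU_upper i j h
  have hLdet : IsUnit L.det := by
    rw [← Matrix.det_transpose, Matrix.det_of_isUpperTriangular hLt]
    simp [hL_diag]
  have hUdet : IsUnit Uᵀ.det := by
    rw [Matrix.det_transpose, Matrix.det_of_isUpperTriangular hUt, isUnit_iff_ne_zero]
    exact Finset.prod_ne_zero_iff.mpr fun i _ => hU_diag i
  have hUA : U = L * A := by rw [hLU, Matrix.mul_nonsing_inv_cancel_left _ _ hLdet]
  have hsymm : (U * Lᵀ).IsSymm := by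
    rw [Matrix.IsSymm, hUA]
    simp [Matrix.transpose_mul, hA.eq, Matrix.mul_assoc]
  have hdiag : (U * Lᵀ).diag = fun i => U i i := by
    ext i
    simp [hUt.mul_apply_diag hLt, hL_diag]
  have hD : Matrix.diagonal (fun i => U i i) = L * Uᵀ := by
    rw [← hdiag, ← (hUt.mul hLt).eq_diagonal_of_isSymm hsymm, ← hsymm.eq,
      Matrix.transpose_mul, Matrix.transpose_transpose]
  intro Λ
  rw [hD, Matrix.mul_inv_rev, Matrix.transpose_mul, Matrix.transpose_mul,
    Matrix.transpose_transpose, Matrix.transpose_nonsing_inv]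
  simp only [Matrix.mul_assoc]
  rw [Matrix.mul_nonsing_inv_cancel_left _ _ hUdet, Matrix.mul_nonsing_inv_cancel_left _ _ hUdet]
end

section
/- Let l : ℕ×ℕ → ℝ encode a lower Hessenberg matrix with unit superdiagonal (l_{i,i+1} = 1 for all i, l_{i,j} = 0 for j ≥ i+2), let h : ℕ → ℝ, and let σ : ℕ → ℝ satisfy σ_i ≠ 0 for all i. Assume the rank one shift condition l_{i,j}h_j + h_i l_{j,i} = σ_iσ_j for all i, j ∈ ℕ. Define A_{i,j} = (l_{i+1,j}/σ_{i+1} − l_{i,j}/σ_i)·h_j for all i, j ∈ ℕ. Then A is a band matrix supported on one subdiagonal and two superdiagonals: A_{i,j} = 0 whenever j ≤ i−2 and whenever j ≥ i+3. -/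
/-- Under the rank one shift condition, the matrix
`A = (Λ − Id)·D_σ⁻¹·L·h`, with entries `A_{i,j} = (l_{i+1,j}/σ_{i+1} − l_{i,j}/σ_i)·h_j`,
is a band matrix supported on one subdiagonal and two superdiagonals:
`A_{i,j} = 0` whenever `j ≤ i−2` or `j ≥ i+3`. -/
theorem stmt4 (l : ℕ → ℕ → ℝ) (h σ : ℕ → ℝ)
    (hsup : ∀ i, l i (i + 1) = 1)
    (hband : ∀ i j, i + 2 ≤ j → l i j = 0)
    (hσ : ∀ i, σ i ≠ 0)
    (hrank1 : ∀ i j, l i j * h j + h i * l j i = σ i * σ j) :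
    ∀ i j, (j + 2 ≤ i ∨ i + 3 ≤ j) →
      (l (i + 1) j / σ (i + 1) - l i j / σ i) * h j = 0 := by
  rintro i j (hij | hij)
  · have h₁ := hrank1 (i + 1) j
    have h₂ := hrank1 i j
    rw [hband j (i + 1) (by lia), mul_zero, add_zero] at h₁
    rw [hband j i hij, mul_zero, add_zero] at h₂
    rw [sub_mul, div_mul_eq_mul_div, div_mul_eq_mul_div, h₁, h₂,
      mul_div_cancel_left₀ _ (hσ _), mul_div_cancel_left₀ _ (hσ _), sub_self]
  · rw [hband (i + 1) j (by lia), hband i j (by lia)]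
    simp
end

section
/- Let ω : (0,∞) → ℝ be measurable such that x ↦ x^k·ω(x) is Lebesgue integrable on (0,∞) for every k ∈ ℕ. Define m_{i,j} = ∫∫_{(0,∞)²} ((x−y)/(x+y))·x^i y^j·ω(x)ω(y) dx dy and α_i = ∫_{(0,∞)} x^i ω(x) dx. Then for all i, j ∈ ℕ: m_{i,j} = −m_{j,i} (skew symmetry), and m_{i+1,j} + m_{i,j+1} = α_{i+1}·α_j − α_i·α_{j+1} (the rank two shift condition). -/
open MeasureTheory

/-- Bi-moments of the Bures ensemble:
`m_{i,j} = ∫∫_{(0,∞)²} ((x−y)/(x+y))·x^i y^j·ω(x)ω(y) dx dy`. -/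
noncomputable def buresMoment (ω : ℝ → ℝ) (i j : ℕ) : ℝ :=
  ∫ p in (Set.Ioi (0:ℝ)) ×ˢ (Set.Ioi (0:ℝ)),
    (p.1 - p.2) / (p.1 + p.2) * (p.1 ^ i * p.2 ^ j) * (ω p.1 * ω p.2)

/-- Single moments `α_i = ∫_{(0,∞)} x^i ω(x) dx`. -/
noncomputable def singleMoment (ω : ℝ → ℝ) (i : ℕ) : ℝ :=
  ∫ x in Set.Ioi (0:ℝ), x ^ i * ω x

theorem volume_restrict_Ioi_prod_Ioi :
    (volume : Measure (ℝ × ℝ)).restrict (Set.Ioi (0:ℝ) ×ˢ Set.Ioi (0:ℝ)) =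
      (volume.restrict (Set.Ioi (0:ℝ))).prod (volume.restrict (Set.Ioi (0:ℝ))) := by
  rw [Measure.prod_restrict, Measure.volume_eq_prod]

theorem norm_sub_div_add_le_one {x y : ℝ} (hx : 0 < x) (hy : 0 < y) :
    ‖(x - y) / (x + y)‖ ≤ 1 := by
  rw [Real.norm_eq_abs, abs_div, abs_of_pos (add_pos hx hy), div_le_one (add_pos hx hy), abs_le]
  constructor <;> linarith

theorem buresMoment_skew (ω : ℝ → ℝ) (i j : ℕ) :
    buresMoment ω i j = -buresMoment ω j i := by
  unfold buresMoment
  rw [volume_restrict_Ioi_prod_Ioi, ← integral_prod_swap, ← integral_neg]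
  refine integral_congr_ae (Filter.Eventually.of_forall fun p => ?_)
  simp only [Prod.fst_swap, Prod.snd_swap]
  rw [add_comm p.2 p.1, ← neg_sub p.1 p.2]
  ring

theorem integrable_pow_mul_pow {ω : ℝ → ℝ}
    (h1 : ∀ k : ℕ, IntegrableOn (fun x => x ^ k * ω x) (Set.Ioi (0:ℝ))) (i j : ℕ) :
    Integrable (fun p : ℝ × ℝ => p.1 ^ i * ω p.1 * (p.2 ^ j * ω p.2))
      ((volume.restrict (Set.Ioi (0:ℝ))).prod (volume.restrict (Set.Ioi (0:ℝ)))) :=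
  Integrable.mul_prod (h1 i) (h1 j)

theorem integrableOn_buresMoment {ω : ℝ → ℝ}
    (h1 : ∀ k : ℕ, IntegrableOn (fun x => x ^ k * ω x) (Set.Ioi (0:ℝ))) (i j : ℕ) :
    IntegrableOn
      (fun p : ℝ × ℝ => (p.1 - p.2) / (p.1 + p.2) * (p.1 ^ i * p.2 ^ j) * (ω p.1 * ω p.2))
      (Set.Ioi (0:ℝ) ×ˢ Set.Ioi (0:ℝ)) := by
  have hint := integrable_pow_mul_pow h1 i j
  rw [← volume_restrict_Ioi_prod_Ioi] at hint
  have hmeas : Measurable fun p : ℝ × ℝ => (p.1 - p.2) / (p.1 + p.2) := by fun_prop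
  have hbound : ∀ᵐ p : ℝ × ℝ ∂volume.restrict (Set.Ioi (0:ℝ) ×ˢ Set.Ioi (0:ℝ)),
      ‖(p.1 - p.2) / (p.1 + p.2)‖ ≤ 1 :=
    (ae_restrict_iff' (measurableSet_Ioi.prod measurableSet_Ioi)).2
      (Filter.Eventually.of_forall fun _ hp => norm_sub_div_add_le_one hp.1 hp.2)
  refine (hint.bdd_mul hmeas.aestronglyMeasurable hbound).congr
    (Filter.Eventually.of_forall fun p => ?_)
  ring

theorem buresMoment_rank_two_shift {ω : ℝ → ℝ}
    (h1 : ∀ k : ℕ, IntegrableOn (fun x => x ^ k * ω x) (Set.Ioi (0:ℝ))) (i j : ℕ) :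
    buresMoment ω (i + 1) j + buresMoment ω i (j + 1) =
      singleMoment ω (i + 1) * singleMoment ω j -
        singleMoment ω i * singleMoment ω (j + 1) := by
  unfold buresMoment singleMoment
  rw [← integral_add (integrableOn_buresMoment h1 (i + 1) j)
      (integrableOn_buresMoment h1 i (j + 1)),
    ← integral_prod_mul, ← integral_prod_mul,
    ← integral_sub (integrable_pow_mul_pow h1 (i + 1) j) (integrable_pow_mul_pow h1 i (j + 1)),
    ← volume_restrict_Ioi_prod_Ioi]
  refine setIntegral_congr_fun (measurableSet_Ioi.prod measurableSet_Ioi) fun p hp => ?_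
  have hne : p.1 + p.2 ≠ 0 := (add_pos hp.1 hp.2).ne'
  field_simp
  ring

/-- The Bures bi-moments are skew-symmetric, `m_{i,j} = −m_{j,i}`, and satisfy
the rank two shift condition `m_{i+1,j} + m_{i,j+1} = α_{i+1} α_j − α_i α_{j+1}`. -/
theorem stmt6 (ω : ℝ → ℝ) (hω : Measurable ω)
    (h1 : ∀ k : ℕ, IntegrableOn (fun x => x ^ k * ω x) (Set.Ioi (0:ℝ))) :
    ∀ i j : ℕ,
      buresMoment ω i j = -buresMoment ω j i ∧
      buresMoment ω (i + 1) j + buresMoment ω i (j + 1) =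
        singleMoment ω (i + 1) * singleMoment ω j -
          singleMoment ω i * singleMoment ω (j + 1) := by
  exact fun i j => ⟨buresMoment_skew ω i j, buresMoment_rank_two_shift h1 i j⟩
end

section
/- Let A be a 2k×2k real skew-symmetric matrix all of whose leading principal submatrices of even sizes 2, 4, …, 2k are invertible. Then there exist a 2k×2k real matrix S which is block unit lower triangular with respect to the partition into 2×2 blocks (each diagonal 2×2 block of S equals the 2×2 identity and every block of S above the block diagonal is zero) and nonzero real numbers g₁, …, g_k such that A = S⁻¹·h·S⁻ᵀ, where h is the block diagonal matrix with 2×2 diagonal blocks [[0, g_j],[−g_j, 0]] for j = 1, …, k. Moreover, for each j = 1, …, k the leading principal 2j×2j submatrix of A has determinant (g₁·g₂⋯g_j)². -/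
open Matrix

/-- The block diagonal matrix with `2 × 2` diagonal blocks `[[0, g j], [-g j, 0]]`. -/
def skewBlockDiagonal (k : ℕ) (g : ℕ → ℝ) : Matrix (Fin (2 * k)) (Fin (2 * k)) ℝ :=
  Matrix.of fun i j =>
    if (i : ℕ) / 2 = (j : ℕ) / 2 then
      (if (i : ℕ) + 1 = (j : ℕ) then g ((i : ℕ) / 2)
       else if (j : ℕ) + 1 = (i : ℕ) then -g ((i : ℕ) / 2) else 0)
    else 0

theorem two_mul_le_two_mul_of_le {j k : ℕ} (h : j ≤ k) : 2 * j ≤ 2 * k :=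
  Nat.mul_le_mul_left 2 h

/-- The leading principal submatrix of order `2 * j`. -/
def leadingEvenSubmatrix {j k : ℕ} (A : Matrix (Fin (2 * k)) (Fin (2 * k)) ℝ) (h : j ≤ k) :
    Matrix (Fin (2 * j)) (Fin (2 * j)) ℝ :=
  A.submatrix (Fin.castLE (two_mul_le_two_mul_of_le h)) (Fin.castLE (two_mul_le_two_mul_of_le h))

@[simp]
theorem leadingEvenSubmatrix_self {k : ℕ} (A : Matrix (Fin (2 * k)) (Fin (2 * k)) ℝ)
    (h : k ≤ k) : leadingEvenSubmatrix A h = A := by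
  simp [leadingEvenSubmatrix]

/-- The equivalence splitting off the last block of size two. -/
def lastBlockEquiv (k : ℕ) : Fin (2 * k) ⊕ Fin 2 ≃ Fin (2 * (k + 1)) :=
  finSumFinEquiv

@[simp]
theorem lastBlockEquiv_inl_val (k : ℕ) (a : Fin (2 * k)) :
    (lastBlockEquiv k (Sum.inl a) : ℕ) = a := by
  rfl

@[simp]
theorem lastBlockEquiv_inr_val (k : ℕ) (b : Fin 2) :
    (lastBlockEquiv k (Sum.inr b) : ℕ) = 2 * k + b := by
  rfl

theorem eq_of_transpose_eq_neg_fin_two {N : Matrix (Fin 2) (Fin 2) ℝ} (hN : Nᵀ = -N) :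
    N = !![0, N 0 1; -N 0 1, 0] := by
  have h (i j : Fin 2) : N j i = -N i j := by simpa using congrFun (congrFun hN i) j
  ext i j
  fin_cases i <;> fin_cases j <;> simp
  · linarith [h 0 0]
  · exact h 0 1
  · linarith [h 1 1]

theorem skewBlockDiagonal_succ (k : ℕ) (g : ℕ → ℝ) :
    (skewBlockDiagonal (k + 1) g).submatrix (lastBlockEquiv k) (lastBlockEquiv k) =
      fromBlocks (skewBlockDiagonal k g) 0 0 !![0, g k; -g k, 0] := by
  ext (a | b) (c | d)
  · simp [skewBlockDiagonal]
  · have : (a : ℕ) / 2 ≠ (2 * k + d) / 2 := by omega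
    simp [skewBlockDiagonal, this]
  · have : (2 * k + b) / 2 ≠ (c : ℕ) / 2 := by omega
    simp [skewBlockDiagonal, this]
  · have h : (2 * k + 1) / 2 = k := by omega
    have h' : 2 * k + 1 + 1 ≠ 2 * k := by omega
    fin_cases b <;> fin_cases d <;> simp [skewBlockDiagonal, h, h']

theorem skewBlockDiagonal_congr {k : ℕ} {g g' : ℕ → ℝ} (h : ∀ j < k, g j = g' j) :
    skewBlockDiagonal k g = skewBlockDiagonal k g' := by
  ext i j
  have : g ((i : ℕ) / 2) = g' ((i : ℕ) / 2) := h _ (by omega)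
  simp [skewBlockDiagonal, this]

theorem transpose_inv_of_transpose_eq_neg {m : Type*} [Fintype m] [DecidableEq m]
    {M : Matrix m m ℝ} (hM : Mᵀ = -M) (hdet : IsUnit M.det) : (M⁻¹)ᵀ = -M⁻¹ := by
  rw [transpose_nonsing_inv, hM]
  exact inv_eq_left_inv (by simp [nonsing_inv_mul M hdet])

/-- Congruence by the block lower triangular factor of the Schur complement reduces a
skew-symmetric block matrix to block diagonal form. -/
theorem fromBlocks_skew_congruence {m n : Type*} [Fintype m] [Fintype n] [DecidableEq m]
    [DecidableEq n] (M S : Matrix m m ℝ) (C : Matrix n m ℝ) (D : Matrix n n ℝ)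
    (hM : Mᵀ = -M) (hdet : IsUnit M.det) :
    fromBlocks S 0 (-(C * M⁻¹)) 1 * fromBlocks M (-Cᵀ) C D *
      (fromBlocks S 0 (-(C * M⁻¹)) 1)ᵀ =
      fromBlocks (S * M * Sᵀ) 0 0 (D + C * M⁻¹ * Cᵀ) := by
  have hinv := transpose_inv_of_transpose_eq_neg hM hdet
  have h₁ : C * M⁻¹ * M = C := by rw [Matrix.mul_assoc, nonsing_inv_mul M hdet, Matrix.mul_one]
  have h₂ : S * M * (M⁻¹ * Cᵀ) = S * Cᵀ := by
    rw [Matrix.mul_assoc, ← Matrix.mul_assoc M, mul_nonsing_inv M hdet, Matrix.one_mul]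
  simp [fromBlocks_transpose, fromBlocks_multiply, hinv, h₁, h₂, add_comm]

theorem exists_skew_congruence (k : ℕ) (A : Matrix (Fin (2 * k)) (Fin (2 * k)) ℝ)
    (hskew : Aᵀ = -A)
    (hminor : ∀ (j : ℕ) (hjk : j ≤ k), (leadingEvenSubmatrix A hjk).det ≠ 0) :
    ∃ (S : Matrix (Fin (2 * k)) (Fin (2 * k)) ℝ) (g : ℕ → ℝ),
      (∀ j < k, g j ≠ 0) ∧
      (∀ i j : Fin (2 * k), (i : ℕ) / 2 < (j : ℕ) / 2 → S i j = 0) ∧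
      (∀ i j : Fin (2 * k), (i : ℕ) / 2 = (j : ℕ) / 2 → S i j = if i = j then 1 else 0) ∧
      S.det = 1 ∧
      S * A * Sᵀ = skewBlockDiagonal k g ∧
      (∀ (j : ℕ) (hjk : j ≤ k),
        (leadingEvenSubmatrix A hjk).det = (∏ i ∈ Finset.range j, g i) ^ 2) := by
  induction k with
  | zero =>
    refine ⟨1, 0, by simp, fun i => i.elim0, fun i => i.elim0, by simp,
      Matrix.ext fun i => i.elim0, fun j hj => ?_⟩
    obtain rfl : j = 0 := by omega
    simp
  | succ k ih =>
    have hskew' (i j) : A j i = -A i j := by simpa using congrFun (congrFun hskew i) j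
    set e := lastBlockEquiv k with he
    set M : Matrix (Fin (2 * k)) (Fin (2 * k)) ℝ :=
      A.submatrix (e ∘ Sum.inl) (e ∘ Sum.inl) with hM
    set C : Matrix (Fin 2) (Fin (2 * k)) ℝ := A.submatrix (e ∘ Sum.inr) (e ∘ Sum.inl) with hC
    set D : Matrix (Fin 2) (Fin 2) ℝ := A.submatrix (e ∘ Sum.inr) (e ∘ Sum.inr) with hD
    have hblocks : A.submatrix e e = fromBlocks M (-Cᵀ) C D := by
      ext (a | b) (c | d) <;> simp [hM, hC, hD]
      exact hskew' _ _
    have hMsub (j : ℕ) (hj : j ≤ k) :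
        leadingEvenSubmatrix M hj = leadingEvenSubmatrix A (hj.trans k.le_succ) := by
      ext x y
      rfl
    have hMskew : Mᵀ = -M := by
      ext i j
      exact hskew' _ _
    obtain ⟨S, g, hg, hupper, hdiag, hS, hSM, hdet⟩ := ih M hMskew fun j hj => by
      rw [hMsub j hj]
      exact hminor j (by omega)
    have hMdet : M.det = (∏ i ∈ Finset.range k, g i) ^ 2 := by
      simpa using hdet k le_rfl
    have hMunit : IsUnit M.det := by
      rw [hMdet, isUnit_iff_ne_zero]
      exact pow_ne_zero _ (Finset.prod_ne_zero_iff.2 fun i hi => hg i (Finset.mem_range.1 hi))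
    set T : Matrix (Fin (2 * k) ⊕ Fin 2) (Fin (2 * k) ⊕ Fin 2) ℝ :=
      fromBlocks S 0 (-(C * M⁻¹)) 1 with hT
    have hTdet : T.det = 1 := by simp [hT, hS]
    set N := D + C * M⁻¹ * Cᵀ with hN
    have hcongr : T * A.submatrix e e * Tᵀ = fromBlocks (skewBlockDiagonal k g) 0 0 N := by
      rw [hblocks, fromBlocks_skew_congruence M S C D hMskew hMunit, hSM]
    have hNskew : Nᵀ = -N := by
      have hDskew : Dᵀ = -D := by
        ext i j
        exact hskew' _ _
      have hinv := transpose_inv_of_transpose_eq_neg hMskew hMunit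
      simp [hN, hDskew, hinv, Matrix.mul_assoc, add_comm]
    have hNform := eq_of_transpose_eq_neg_fin_two hNskew
    have hAdet : A.det = (∏ i ∈ Finset.range k, g i) ^ 2 * N 0 1 ^ 2 := by
      have h := congrArg det hcongr
      have hSMdet := congrArg det hSM
      simp only [det_mul, det_transpose, hS, hTdet, one_mul, mul_one, det_fromBlocks_zero₂₁,
        det_submatrix_equiv_self] at h hSMdet
      have hNdet := congrArg det hNform
      rw [det_fin_two_of] at hNdet
      rw [h, ← hSMdet, hMdet, hNdet]
      ring
    have hAne : A.det ≠ 0 := by simpa using hminor (k + 1) le_rfl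
    set g' : ℕ → ℝ := Function.update g k (N 0 1) with hg'
    have hg'lt (j : ℕ) (hj : j < k) : g' j = g j := Function.update_of_ne hj.ne _ _
    have hg'k : g' k = N 0 1 := Function.update_self ..
    have hprod (j : ℕ) (hj : j ≤ k) : ∏ i ∈ Finset.range j, g' i = ∏ i ∈ Finset.range j, g i :=
      Finset.prod_congr rfl fun i hi => hg'lt i ((Finset.mem_range.1 hi).trans_le hj)
    refine ⟨T.submatrix e.symm e.symm, g', fun j hj => ?_, fun i j hij => ?_, fun i j hij => ?_,
      by simp [hTdet], ?_, fun j hj => ?_⟩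
    · rcases Nat.lt_succ_iff_lt_or_eq.1 hj with h | rfl
      · rw [hg'lt j h]
        exact hg j h
      · rw [hg'k]
        rintro h
        simp [hAdet, h] at hAne
    · obtain ⟨x, rfl⟩ := e.surjective i
      obtain ⟨y, rfl⟩ := e.surjective j
      rcases x with a | b <;> rcases y with c | d <;> simp [he, hT] at hij ⊢
      · exact hupper a c hij
      · omega
      · omega
    · obtain ⟨x, rfl⟩ := e.surjective i
      obtain ⟨y, rfl⟩ := e.surjective j
      rcases x with a | b <;> rcases y with c | d <;> simp [he, hT] at hij ⊢
      · exact hdiag a c hij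
      · omega
      · exact Matrix.one_apply
    · have h : skewBlockDiagonal (k + 1) g' =
          (T * A.submatrix e e * Tᵀ).submatrix e.symm e.symm := by
        rw [hcongr, hNform, ← hg'k, ← skewBlockDiagonal_congr hg'lt, ← skewBlockDiagonal_succ]
        simp [he]
      rw [h, ← submatrix_mul_equiv _ _ _ e.symm, ← submatrix_mul_equiv _ _ _ e.symm]
      simp
    · rcases Nat.le_succ_iff.1 hj with h | rfl
      · rw [← hMsub j h, hdet j h, hprod j h]
      · rw [Finset.prod_range_succ, hprod k le_rfl, hg'k, mul_pow, ← hAdet]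
        simp

/-- A 2k×2k real skew-symmetric matrix `A` whose leading principal submatrices
of even sizes 2, 4, …, 2k are invertible admits a skew-symmetric Cholesky-type
factorization `A = S⁻¹ · h · S⁻ᵀ` with `S` block unit lower triangular (w.r.t. 2×2 blocks)
and `h` block diagonal with 2×2 blocks `[[0, gⱼ],[−gⱼ, 0]]`, `gⱼ ≠ 0`; moreover the leading
principal 2j×2j minor of `A` equals `(g₁⋯gⱼ)²`. -/
theorem stmt8 (k : ℕ) (A : Matrix (Fin (2 * k)) (Fin (2 * k)) ℝ)
    (hskew : Aᵀ = -A)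
    (hminor : ∀ (j : ℕ) (_ : 1 ≤ j) (hjk : j ≤ k),
      (A.submatrix (Fin.castLE (by omega : 2 * j ≤ 2 * k))
        (Fin.castLE (by omega : 2 * j ≤ 2 * k))).det ≠ 0) :
    ∃ (S : Matrix (Fin (2 * k)) (Fin (2 * k)) ℝ) (g : ℕ → ℝ),
      (∀ j < k, g j ≠ 0) ∧
      (∀ i j : Fin (2 * k), (i : ℕ) / 2 < (j : ℕ) / 2 → S i j = 0) ∧
      (∀ i j : Fin (2 * k), (i : ℕ) / 2 = (j : ℕ) / 2 →
        S i j = if i = j then 1 else 0) ∧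
      A = S⁻¹ *
        (Matrix.of fun i j : Fin (2 * k) =>
          if (i : ℕ) / 2 = (j : ℕ) / 2 then
            (if (i : ℕ) + 1 = (j : ℕ) then g ((i : ℕ) / 2)
             else if (j : ℕ) + 1 = (i : ℕ) then -g ((i : ℕ) / 2) else 0)
          else 0) * (S⁻¹)ᵀ ∧
      (∀ (j : ℕ) (_ : 1 ≤ j) (hjk : j ≤ k),
        (A.submatrix (Fin.castLE (by omega : 2 * j ≤ 2 * k))
          (Fin.castLE (by omega : 2 * j ≤ 2 * k))).det =
          (∏ i ∈ Finset.range j, g i) ^ 2) := by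
  obtain ⟨S, g, hg, hupper, hdiag, hS, hSA, hdet⟩ :=
    exists_skew_congruence k A hskew fun j hjk => by
      rcases Nat.eq_zero_or_pos j with rfl | hj
      · simp
      · exact hminor j hj hjk
  have hunit : IsUnit S.det := by simp [hS]
  have hunit' : IsUnit Sᵀ.det := by simp [hS]
  refine ⟨S, g, hg, hupper, hdiag, ?_, fun j _ hjk => hdet j hjk⟩
  change A = S⁻¹ * skewBlockDiagonal k g * (S⁻¹)ᵀ
  rw [← hSA, transpose_nonsing_inv, ← Matrix.mul_assoc, nonsing_inv_mul_cancel_left _ _ hunit,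
    mul_nonsing_inv_cancel_right _ _ hunit']
end

section
/- Let m_{i,j} ∈ ℝ (i, j ∈ ℕ) with m_{i,j} = −m_{j,i} and α_i ∈ ℝ (i ∈ ℕ); define τ̂_{2n}, τ̂_{2n+1} and the partial skew orthogonal polynomials P̃_n(x) as Pfaffians as in the paper, and assume τ̂_k ≠ 0 for all k. For n ≥ 1 define the odd skew orthogonal polynomial P_{2n+1}(x) = (1/τ̂_{2n})·Pf(K⁽ⁿ⁾(x)), where K⁽ⁿ⁾(x) is the (2n+2)×(2n+2) skew-symmetric matrix built from the index list (0, 1, …, 2n−1, 2n+1) — entries m_{i_k,i_l} for the listed indices i_k, i_l — bordered by the last column with entries x^{i_k}. Then for all n ≥ 1: P_{2n+1}(x) = P̃_{2n+1}(x) + a_n·P̃_{2n}(x) + b_n·P̃_{2n−1}(x), where a_n = Pf(D⁽ⁿ⁾)/τ̂_{2n+1}, with D⁽ⁿ⁾ the (2n+2)×(2n+2) skew-symmetric matrix built from the index list (0, …, 2n−1, 2n+1) bordered by a first row with entries α_{i_k}, and b_n = −τ̂_{2n+2}·τ̂_{2n−1}/(τ̂_{2n}·τ̂_{2n+1}). 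-/
open Polynomial

/-- The Pfaffian of a 2N×2N matrix over a commutative ℚ-algebra:
`Pf(A) = (1/(2^N N!)) Σ_{π∈S_{2N}} sgn(π) ∏_{k=1}^N a_{π(2k−1),π(2k)}`. -/
noncomputable def pfaffian {R : Type*} [CommRing R] [Algebra ℚ R] {N : ℕ}
    (A : Matrix (Fin (2 * N)) (Fin (2 * N)) R) : R :=
  algebraMap ℚ R (1 / (2 ^ N * N.factorial : ℚ)) *
    ∑ π : Equiv.Perm (Fin (2 * N)), (Equiv.Perm.sign π : ℤ) •
      ∏ k : Fin N,
        A (π ⟨2 * (k : ℕ), by have := k.isLt; omega⟩)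
          (π ⟨2 * (k : ℕ) + 1, by have := k.isLt; omega⟩)

/-- `τ̂_{2n} = Pf((m_{i,j})_{i,j=0}^{2n−1})`. -/
noncomputable def tauEven (m : ℕ → ℕ → ℝ) (n : ℕ) : ℝ :=
  pfaffian (Matrix.of fun i j : Fin (2 * n) => m i j)

/-- `τ̂_{2n+1} = Pf` of `(m_{i,j})_{i,j=0}^{2n}` bordered by the row `(α_0, …, α_{2n})`. -/
noncomputable def tauOdd (m : ℕ → ℕ → ℝ) (α : ℕ → ℝ) (n : ℕ) : ℝ :=
  pfaffian (Matrix.of fun i j : Fin (2 * (n + 1)) =>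
    if (i : ℕ) = 0 then (if (j : ℕ) = 0 then 0 else α ((j : ℕ) - 1))
    else if (j : ℕ) = 0 then -α ((i : ℕ) - 1)
    else m ((i : ℕ) - 1) ((j : ℕ) - 1))

/-- The combined tau function sequence: `τ̂_{2n} = tauEven n`, `τ̂_{2n+1} = tauOdd n`. -/
noncomputable def tauhat (m : ℕ → ℕ → ℝ) (α : ℕ → ℝ) (n : ℕ) : ℝ :=
  if n % 2 = 0 then tauEven m (n / 2) else tauOdd m α (n / 2)

/-- The partial skew orthogonal polynomial `P̃_{2n}(x)`. -/
noncomputable def ptildeEven (m : ℕ → ℕ → ℝ) (α : ℕ → ℝ) (n : ℕ) : Polynomial ℝ :=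
  (tauhat m α (2 * n))⁻¹ •
    pfaffian (Matrix.of fun i j : Fin (2 * (n + 1)) =>
      if (i : ℕ) = 2 * n + 1 then (if (j : ℕ) = 2 * n + 1 then 0 else -(X ^ (j : ℕ)))
      else if (j : ℕ) = 2 * n + 1 then X ^ (i : ℕ)
      else C (m i j))

/-- The partial skew orthogonal polynomial `P̃_{2n+1}(x)`. -/
noncomputable def ptildeOdd (m : ℕ → ℕ → ℝ) (α : ℕ → ℝ) (n : ℕ) : Polynomial ℝ :=
  (tauhat m α (2 * n + 1))⁻¹ •
    pfaffian (Matrix.of fun i j : Fin (2 * (n + 2)) =>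
      if (i : ℕ) = 0 then
        (if (j : ℕ) = 0 then 0 else if (j : ℕ) = 2 * n + 3 then 0
         else C (α ((j : ℕ) - 1)))
      else if (i : ℕ) = 2 * n + 3 then
        (if (j : ℕ) = 0 then 0 else if (j : ℕ) = 2 * n + 3 then 0
         else -(X ^ ((j : ℕ) - 1)))
      else if (j : ℕ) = 0 then -C (α ((i : ℕ) - 1))
      else if (j : ℕ) = 2 * n + 3 then X ^ ((i : ℕ) - 1)
      else C (m ((i : ℕ) - 1) ((j : ℕ) - 1)))

/-- The combined family of partial skew orthogonal polynomials. -/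
noncomputable def ptilde (m : ℕ → ℕ → ℝ) (α : ℕ → ℝ) (n : ℕ) : Polynomial ℝ :=
  if n % 2 = 0 then ptildeEven m α (n / 2) else ptildeOdd m α (n / 2)

/-- The index list `(0, 1, …, 2n−1, 2n+1)`: for `k ≤ 2n`, `idxK n k = k` if `k < 2n` and
`idxK n (2n) = 2n+1`. -/
def idxK (n k : ℕ) : ℕ := if k = 2 * n then 2 * n + 1 else k

/-- The odd skew orthogonal polynomial `P_{2n+1}(x) = (1/τ̂_{2n})·Pf(K⁽ⁿ⁾(x))`, where
`K⁽ⁿ⁾(x)` is built from the index list `(0, 1, …, 2n−1, 2n+1)` bordered by the x-column. -/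
noncomputable def pSkewOdd (m : ℕ → ℕ → ℝ) (α : ℕ → ℝ) (n : ℕ) : Polynomial ℝ :=
  (tauhat m α (2 * n))⁻¹ •
    pfaffian (Matrix.of fun i j : Fin (2 * (n + 1)) =>
      if (i : ℕ) = 2 * n + 1 then
        (if (j : ℕ) = 2 * n + 1 then 0 else -(X ^ idxK n (j : ℕ)))
      else if (j : ℕ) = 2 * n + 1 then X ^ idxK n (i : ℕ)
      else C (m (idxK n (i : ℕ)) (idxK n (j : ℕ))))

/-- `Pf(D⁽ⁿ⁾)`: the Pfaffian of the matrix built from the index list `(0, …, 2n−1, 2n+1)`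
bordered by a first row with entries `α_{i_k}`. -/
noncomputable def pfD (m : ℕ → ℕ → ℝ) (α : ℕ → ℝ) (n : ℕ) : ℝ :=
  pfaffian (Matrix.of fun i j : Fin (2 * (n + 1)) =>
    if (i : ℕ) = 0 then (if (j : ℕ) = 0 then 0 else α (idxK n ((j : ℕ) - 1)))
    else if (j : ℕ) = 0 then -α (idxK n ((i : ℕ) - 1))
    else m (idxK n ((i : ℕ) - 1)) (idxK n ((j : ℕ) - 1)))

theorem pfaffian_map {R S : Type*} [CommRing R] [CommRing S] [Algebra ℚ R] [Algebra ℚ S]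
    (f : R →+* S) {N : ℕ} (A : Matrix (Fin (2 * N)) (Fin (2 * N)) R) :
    f (pfaffian A) = pfaffian (A.map f) := by
  simp only [pfaffian, map_mul, map_sum, map_zsmul, map_prod, Matrix.map_apply]
  rw [RingHom.map_rat_algebraMap]

section Expansion

variable {R : Type*} [CommRing R] {N : ℕ}

/-- The summand of the Pfaffian attached to a permutation. -/
def pfaffianTerm (A : Matrix (Fin (2 * N)) (Fin (2 * N)) R) (π : Equiv.Perm (Fin (2 * N))) : R :=
  (Equiv.Perm.sign π : ℤ) •
      ∏ k : Fin N,
        A (π ⟨2 * (k : ℕ), by have := k.isLt; omega⟩)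
          (π ⟨2 * (k : ℕ) + 1, by have := k.isLt; omega⟩)

theorem pfaffian_eq_sum_term [Algebra ℚ R] (A : Matrix (Fin (2 * N)) (Fin (2 * N)) R) :
    pfaffian A = algebraMap ℚ R (1 / (2 ^ N * N.factorial : ℚ)) * ∑ π, pfaffianTerm A π :=
  rfl

theorem pfaffianTerm_submatrix (A : Matrix (Fin (2 * N)) (Fin (2 * N)) R)
    (σ π : Equiv.Perm (Fin (2 * N))) :
    pfaffianTerm (A.submatrix σ σ) π = (Equiv.Perm.sign σ : ℤ) • pfaffianTerm A (σ * π) := by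
  have h : ((Equiv.Perm.sign σ : ℤ)) * (Equiv.Perm.sign σ : ℤ) = 1 := by
    rw [← Units.val_mul, Int.units_mul_self, Units.val_one]
  simp only [pfaffianTerm, Equiv.Perm.sign_mul, Units.val_mul, smul_smul, ← mul_assoc, h, one_mul,
    Matrix.submatrix_apply, Equiv.Perm.mul_apply]

/-- Reordering rows and columns simultaneously multiplies the Pfaffian by the sign. -/
theorem pfaffian_submatrix_perm [Algebra ℚ R] (A : Matrix (Fin (2 * N)) (Fin (2 * N)) R)
    (σ : Equiv.Perm (Fin (2 * N))) :
    pfaffian (A.submatrix σ σ) = (Equiv.Perm.sign σ : ℤ) • pfaffian A := by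
  simp only [pfaffian_eq_sum_term, pfaffianTerm_submatrix, ← Finset.smul_sum]
  rw [mul_smul_comm]
  congr 2
  exact Equiv.sum_comp (Equiv.mulLeft σ) (pfaffianTerm A)

theorem pfaffianTerm_mul_swap_zero_one (A : Matrix (Fin (2 * (N + 1))) (Fin (2 * (N + 1))) R)
    (hA : ∀ i j, A i j = -A j i) (π : Equiv.Perm (Fin (2 * (N + 1)))) :
    pfaffianTerm A (π * Equiv.swap ⟨0, by omega⟩ ⟨1, by omega⟩) = pfaffianTerm A π := by
  have h : ∀ k : Fin N, ∀ r : ℕ, ∀ hr : 2 * ((k : ℕ) + 1) + r < 2 * (N + 1),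
      Equiv.swap (⟨0, by omega⟩ : Fin (2 * (N + 1))) ⟨1, by omega⟩ ⟨2 * ((k : ℕ) + 1) + r, hr⟩
        = ⟨2 * ((k : ℕ) + 1) + r, hr⟩ := fun k r hr =>
    Equiv.swap_apply_of_ne_of_ne (by simp) (by simp; omega)
  have h0 := fun k : Fin N => h k 0 (by omega)
  have h1 := fun k : Fin N => h k 1 (by omega)
  simp only [add_zero] at h0
  simp only [pfaffianTerm, Equiv.Perm.sign_mul, Fin.prod_univ_succ, Equiv.Perm.mul_apply,
    Fin.val_succ, h0, h1, Fin.val_zero, mul_zero, zero_add, Equiv.swap_apply_left,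
    Equiv.swap_apply_right]
  rw [Equiv.Perm.sign_swap (by simp), hA (π ⟨1, _⟩)]
  simp

theorem exists_perm_pair_swap (k : Fin (N + 1)) :
    ∃ τ : Equiv.Perm (Fin (2 * (N + 1))),
      τ ⟨0, by omega⟩ = ⟨2 * (k : ℕ), by omega⟩ ∧ τ ⟨1, by omega⟩ = ⟨2 * (k : ℕ) + 1, by omega⟩ ∧
      ∀ (A : Matrix (Fin (2 * (N + 1))) (Fin (2 * (N + 1))) R) (π : Equiv.Perm _),
        pfaffianTerm A (π * τ) = pfaffianTerm A π := by
  let ev : Fin (N + 1) → Fin (2 * (N + 1)) := fun j => ⟨2 * (j : ℕ), by omega⟩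
  let od : Fin (N + 1) → Fin (2 * (N + 1)) := fun j => ⟨2 * (j : ℕ) + 1, by omega⟩
  have hev : Function.Injective ev := fun a b h => by
    simp only [ev, Fin.mk.injEq] at h; omega
  have hod : Function.Injective od := fun a b h => by
    simp only [od, Fin.mk.injEq] at h; omega
  have hne : ∀ a b, ev a ≠ od b := fun a b h => by
    simp only [ev, od, Fin.mk.injEq] at h; omega
  let τ := Equiv.swap (ev 0) (ev k) * Equiv.swap (od 0) (od k)
  have h1 : ∀ j, τ (ev j) = ev (Equiv.swap 0 k j) := fun j => by
    simp only [τ, Equiv.Perm.mul_apply]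
    rw [Equiv.swap_apply_of_ne_of_ne (hne _ _) (hne _ _), hev.swap_apply]
  have h2 : ∀ j, τ (od j) = od (Equiv.swap 0 k j) := fun j => by
    simp only [τ, Equiv.Perm.mul_apply]
    rw [hod.swap_apply, Equiv.swap_apply_of_ne_of_ne (hne _ _).symm (hne _ _).symm]
  have hs : Equiv.Perm.sign τ = 1 := by
    simp only [τ, Equiv.Perm.sign_mul, Equiv.Perm.sign_swap', hev.eq_iff, hod.eq_iff]
    split_ifs <;> simp
  refine ⟨τ, (h1 0).trans (by simp [ev]), (h2 0).trans (by simp [od]), fun A π => ?_⟩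
  simp only [pfaffianTerm, Equiv.Perm.sign_mul, hs, mul_one, Equiv.Perm.mul_apply]
  congr 1
  refine Eq.trans ?_ (Equiv.prod_comp (Equiv.swap 0 k) fun j => A (π (ev j)) (π (od j)))
  exact Finset.prod_congr rfl fun j _ => congrArg₂ A (congrArg π (h1 j)) (congrArg π (h2 j))

theorem exists_perm_pfaffianTerm_mul (A : Matrix (Fin (2 * (N + 1))) (Fin (2 * (N + 1))) R)
    (hA : ∀ i j, A i j = -A j i) (p : Fin (2 * (N + 1))) :
    ∃ τ : Equiv.Perm (Fin (2 * (N + 1))),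
      τ ⟨0, by omega⟩ = p ∧ ∀ π, pfaffianTerm A (π * τ) = pfaffianTerm A π := by
  obtain ⟨τ, h0, h1, hτ⟩ := exists_perm_pair_swap (R := R) (N := N) ⟨p / 2, by omega⟩
  rcases Nat.mod_two_eq_zero_or_one p with h | h
  · exact ⟨τ, h0.trans (Fin.ext (by simp; omega)), hτ A⟩
  · refine ⟨τ * Equiv.swap ⟨0, by omega⟩ ⟨1, by omega⟩, ?_, fun π => ?_⟩
    · rw [Equiv.Perm.mul_apply, Equiv.swap_apply_left, h1]
      exact Fin.ext (by simp; omega)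
    · rw [← mul_assoc, pfaffianTerm_mul_swap_zero_one A hA, hτ]

theorem sum_pfaffianTerm (A : Matrix (Fin (2 * (N + 1))) (Fin (2 * (N + 1))) R)
    (hA : ∀ i j, A i j = -A j i) :
    ∑ π, pfaffianTerm A π = (2 * (N + 1)) •
      ∑ π : Equiv.Perm (Fin (2 * (N + 1))),
        if π ⟨0, by omega⟩ = ⟨0, by omega⟩ then pfaffianTerm A π else 0 := by
  have h1 : ∀ π : Equiv.Perm (Fin (2 * (N + 1))), pfaffianTerm A π =
      ∑ p, if π p = ⟨0, by omega⟩ then pfaffianTerm A π else 0 := fun π => by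
    simp [← Equiv.eq_symm_apply]
  rw [Finset.sum_congr rfl fun π _ => h1 π, Finset.sum_comm]
  trans ∑ p : Fin (2 * (N + 1)), ∑ π : Equiv.Perm (Fin (2 * (N + 1))),
        if π ⟨0, by omega⟩ = ⟨0, by omega⟩ then pfaffianTerm A π else 0
  · refine Finset.sum_congr rfl fun p _ => ?_
    obtain ⟨τ, hp, hτ⟩ := exists_perm_pfaffianTerm_mul A hA p
    rw [← Equiv.sum_comp (Equiv.mulRight τ)
      fun π => if π ⟨0, by omega⟩ = ⟨0, by omega⟩ then pfaffianTerm A π else 0]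
    simp only [Equiv.coe_mulRight, Equiv.Perm.mul_apply, hτ, hp]
  · simp

theorem sum_perm_apply_zero {n : ℕ} (f : Equiv.Perm (Fin (n + 1)) → R) :
    (∑ π, if π 0 = 0 then f π else 0) = ∑ σ, f (Equiv.Perm.decomposeFin.symm (0, σ)) := by
  rw [← Equiv.Perm.decomposeFin.symm.sum_comp, Fintype.sum_prod_type,
    Finset.sum_eq_single 0 (fun p _ hp => by simp [hp]) (by simp)]
  simp

/-- Classifying permutations by the image of `0`, in order-preserving form. -/
theorem sum_perm_sign_smul {n : ℕ} (f : (Fin (n + 1) → Fin (n + 1)) → R) :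
    ∑ σ : Equiv.Perm (Fin (n + 1)), (Equiv.Perm.sign σ : ℤ) • f σ =
      ∑ i : Fin (n + 1), (-1) ^ (i : ℕ) * ∑ ρ : Equiv.Perm (Fin n),
        (Equiv.Perm.sign ρ : ℤ) • f (Fin.cons i (i.succAbove ∘ ρ)) := by
  rw [← Equiv.Perm.decomposeFin.symm.sum_comp, Fintype.sum_prod_type]
  refine Finset.sum_congr rfl fun i _ => ?_
  cases n with
  | zero =>
    have hi : i = 0 := Subsingleton.elim _ _
    subst hi
    simp
  | succ n =>
  rw [Finset.mul_sum]
  induction i using Fin.cases with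
  | zero =>
    refine Finset.sum_congr rfl fun ρ _ => ?_
    have : (Fin.cons 0 ((0 : Fin (n + 2)).succAbove ∘ ρ) : Fin (n + 2) → Fin (n + 2)) =
        Equiv.Perm.decomposeFin.symm (0, ρ) := by
      funext x
      cases x using Fin.cases <;> simp
    rw [this]
    simp
  | succ i =>
    rw [← Equiv.sum_comp (Equiv.mulLeft i.cycleRange) fun ρ : Equiv.Perm (Fin (n + 1)) => _ * _]
    refine Finset.sum_congr rfl fun ρ _ => ?_
    have : (Fin.cons i.succ (i.succ.succAbove ∘ ⇑(i.cycleRange * ρ)) : Fin (n + 2) → Fin (n + 2)) =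
        Equiv.Perm.decomposeFin.symm (i.succ, ρ) := by
      funext x
      cases x using Fin.cases <;> simp [Fin.succAbove_cycleRange]
    have h : ((-1 : R) ^ (i : ℕ)) * (-1) ^ (i : ℕ) = 1 := by
      rw [← mul_pow]; simp
    simp only [Equiv.coe_mulLeft, this]
    simp [Equiv.Perm.decomposeFin.symm_sign, Fin.sign_cycleRange, pow_succ, ← mul_assoc, h,
      Fin.succ_ne_zero]

/-- Expansion of the Pfaffian of a skew-symmetric matrix along its first row. -/
theorem pfaffian_succ [Algebra ℚ R] (A : Matrix (Fin (2 * (N + 1))) (Fin (2 * (N + 1))) R)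
    (hA : ∀ i j, A i j = -A j i) :
    pfaffian A = ∑ i : Fin (2 * N + 1), (-1) ^ (i : ℕ) * (A ⟨0, by omega⟩ i.succ *
      pfaffian (A.submatrix (fun k : Fin (2 * N) => (i.succAbove k).succ)
        (fun k : Fin (2 * N) => (i.succAbove k).succ))) := by
  have hc : algebraMap ℚ R (1 / (2 ^ (N + 1) * (N + 1).factorial : ℚ)) * ((2 * (N + 1) : ℕ) : R) =
      algebraMap ℚ R (1 / (2 ^ N * N.factorial : ℚ)) := by
    rw [← map_natCast (algebraMap ℚ R), ← map_mul]
    congr 1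
    rw [Nat.factorial_succ]
    push_cast
    field_simp
    ring

  have hT : (∑ π : Equiv.Perm (Fin (2 * (N + 1))),
        if π ⟨0, by omega⟩ = ⟨0, by omega⟩ then pfaffianTerm A π else 0) =
      ∑ σ : Equiv.Perm (Fin (2 * N + 1)), (Equiv.Perm.sign σ : ℤ) •
        (A ⟨0, by omega⟩ (σ 0).succ * ∏ k : Fin N,
          A (σ (Fin.succ ⟨2 * (k : ℕ), by omega⟩)).succ
            (σ (Fin.succ ⟨2 * (k : ℕ) + 1, by omega⟩)).succ) := by
    refine (sum_perm_apply_zero (n := 2 * N + 1) (pfaffianTerm A)).trans ?_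
    refine Finset.sum_congr rfl fun σ _ => ?_
    rw [pfaffianTerm, Fin.prod_univ_succ]
    congr 1
    simp
  rw [pfaffian_eq_sum_term, sum_pfaffianTerm A hA, nsmul_eq_mul, ← mul_assoc, hc]
  refine (congrArg _ (hT.trans (sum_perm_sign_smul (n := 2 * N) fun s => A ⟨0, by omega⟩ (s 0).succ *
    ∏ k : Fin N, A (s (Fin.succ ⟨2 * (k : ℕ), by omega⟩)).succ
      (s (Fin.succ ⟨2 * (k : ℕ) + 1, by omega⟩)).succ))).trans ?_
  rw [Finset.mul_sum]
  refine Finset.sum_congr rfl fun i _ => ?_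
  simp only [pfaffian, Fin.cons_zero, Fin.cons_succ, Function.comp_apply, Matrix.submatrix_apply,
    ← mul_smul_comm, ← Finset.mul_sum]
  ring

end Expansion

section Pluecker

variable {R : Type*} [CommRing R] [Algebra ℚ R] {ι : Type*} {N : ℕ}

/-- The Pfaffian of the matrix `M (v i) (v j)` attached to a list `v` of indices. -/
noncomputable def indexPfaffian (M : ι → ι → R) (v : Fin (2 * N) → ι) : R :=
  pfaffian (Matrix.of fun i j => M (v i) (v j))

theorem indexPfaffian_perm (M : ι → ι → R) (v : Fin (2 * N) → ι) (σ : Equiv.Perm (Fin (2 * N))) :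
    indexPfaffian M (v ∘ σ) = (Equiv.Perm.sign σ : ℤ) • indexPfaffian M v :=
  pfaffian_submatrix_perm (Matrix.of fun i j => M (v i) (v j)) σ

theorem indexPfaffian_eq_zero (M : ι → ι → R) (v : Fin (2 * N) → ι) {i j : Fin (2 * N)}
    (hij : i ≠ j) (hv : v i = v j) : indexPfaffian M v = 0 := by
  have h := indexPfaffian_perm M v (Equiv.swap i j)
  have hs : v ∘ Equiv.swap i j = v := by
    funext k
    simp only [Function.comp_apply, Equiv.swap_apply_def]
    split_ifs <;> simp_all
  rw [hs, Equiv.Perm.sign_swap hij] at h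
  have h2 : (algebraMap ℚ R) (1 / 2) * 2 = 1 := by
    rw [← map_ofNat (algebraMap ℚ R) 2, ← map_mul]
    norm_num
  have h3 : 2 * indexPfaffian M v = 0 := by
    simp only [Units.val_neg, Units.val_one, neg_smul, one_smul] at h
    linear_combination h
  linear_combination (algebraMap ℚ R) (1 / 2) * h3 - h2 * indexPfaffian M v

/-- The list obtained by putting `a` in front of a list of odd length. -/
def consIndex (a : ι) (v : Fin (2 * N + 1) → ι) : Fin (2 * (N + 1)) → ι :=
  Fin.cons (n := 2 * N + 1) (α := fun _ => ι) a v

theorem indexPfaffian_cons (M : ι → ι → R) (hM : ∀ a b, M a b = -M b a) (a : ι)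
    (v : Fin (2 * N + 1) → ι) :
    indexPfaffian M (consIndex a v) =
      ∑ i : Fin (2 * N + 1), (-1) ^ (i : ℕ) * (M a (v i) * indexPfaffian M (N := N) (v ∘ i.succAbove)) :=
  pfaffian_succ (Matrix.of fun i j => M (consIndex a v i) (consIndex a v j)) fun _ _ => hM _ _

theorem indexPfaffian_cons_mem (M : ι → ι → R) (v : Fin (2 * N + 1) → ι) (i : Fin (2 * N + 1)) :
    indexPfaffian M (consIndex (v i) v) = 0 :=
  indexPfaffian_eq_zero M (consIndex (v i) v) (i := ⟨0, by omega⟩) (j := i.succ)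
    (Fin.succ_ne_zero i).symm rfl

/-- Moving the index at position `p` to the front multiplies the Pfaffian by `(-1) ^ p`. -/
theorem indexPfaffian_cons_removeNth (M : ι → ι → R) (v : Fin (2 * N + 2) → ι)
    (p : Fin (2 * N + 2)) :
    indexPfaffian M (consIndex (v p) (v ∘ p.succAbove)) =
      (-1) ^ (p : ℕ) * indexPfaffian M (N := N + 1) v := by
  have hc : consIndex (v p) (v ∘ p.succAbove) = v ∘ p.cycleRange.symm :=
    Fin.cons_removeNth_eq_comp_cycleRange_symm v p
  have hs : Equiv.Perm.sign (p.cycleRange.symm) = (-1) ^ (p : ℕ) := by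
    rw [Equiv.Perm.sign_symm, Fin.sign_cycleRange]
  rw [hc]
  refine (indexPfaffian_perm (N := N + 1) M v p.cycleRange.symm).trans ?_
  refine (congrArg (fun s : ℤˣ => (s : ℤ) • _) hs).trans ?_
  simp [zsmul_eq_mul]

/-- The Plücker relation for Pfaffians: two lists of odd length exchange an index. -/
theorem indexPfaffian_pluecker (M : ι → ι → R) (hM : ∀ a b, M a b = -M b a) {K : ℕ}
    (u : Fin (2 * N + 1) → ι) (w : Fin (2 * K + 1) → ι) :
    ∑ i : Fin (2 * K + 1), (-1) ^ (i : ℕ) *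
        (indexPfaffian M (consIndex (w i) u) * indexPfaffian M (N := K) (w ∘ i.succAbove)) =
      -∑ j : Fin (2 * N + 1), (-1) ^ (j : ℕ) *
        (indexPfaffian M (N := N) (u ∘ j.succAbove) * indexPfaffian M (consIndex (u j) w)) := by
  simp only [indexPfaffian_cons M hM, Finset.sum_mul, Finset.mul_sum, ← Finset.sum_neg_distrib]
  rw [Finset.sum_comm]
  refine Finset.sum_congr rfl fun j _ => Finset.sum_congr rfl fun i _ => ?_
  rw [hM (w i) (u j)]
  ring

end Pluecker

/-- The moments bordered by `α` (index `0`) and by the powers of `X` (index `L`). -/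
noncomputable def borderedMoment (m : ℕ → ℕ → ℝ) (α : ℕ → ℝ) (L i j : ℕ) : Polynomial ℝ :=
  if i = 0 then
    (if j = 0 then 0 else if j = L then 0 else C (α (j - 1)))
  else if i = L then
    (if j = 0 then 0 else if j = L then 0 else -(X ^ (j - 1)))
  else if j = 0 then -C (α (i - 1))
  else if j = L then X ^ (i - 1)
  else C (m (i - 1) (j - 1))

theorem borderedMoment_skew (m : ℕ → ℕ → ℝ) (α : ℕ → ℝ) (hskew : ∀ i j, m i j = -m j i)
    (L i j : ℕ) : borderedMoment m α L i j = -borderedMoment m α L j i := by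
  unfold borderedMoment
  split_ifs <;> first | simp | rw [hskew, map_neg]

theorem C_tauhat_even (m : ℕ → ℕ → ℝ) (α : ℕ → ℝ) {n L : ℕ} (hL : 2 * n < L) :
    C (tauhat m α (2 * n)) =
      indexPfaffian (borderedMoment m α L) (N := n) fun i => (i : ℕ) + 1 := by
  rw [tauhat, if_pos (by omega), Nat.mul_div_cancel_left n two_pos, tauEven, pfaffian_map]
  refine congrArg pfaffian (Matrix.ext fun i j => ?_)
  have := i.isLt
  have := j.isLt
  simp (disch := omega) [borderedMoment, if_neg]

theorem C_tauhat_odd (m : ℕ → ℕ → ℝ) (α : ℕ → ℝ) {n L : ℕ} (hL : 2 * n + 1 < L) :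
    C (tauhat m α (2 * n + 1)) =
      indexPfaffian (borderedMoment m α L) (N := n + 1) fun i => (i : ℕ) := by
  rw [tauhat, if_neg (by omega), show (2 * n + 1) / 2 = n by omega, tauOdd, pfaffian_map]
  refine congrArg pfaffian (Matrix.ext fun i j => ?_)
  have hi : (i : ℕ) ≠ L := by omega
  have hj : (j : ℕ) ≠ L := by omega
  simp only [Matrix.map_apply, Matrix.of_apply, borderedMoment, hi, hj, if_false]
  split_ifs <;> simp

theorem C_pfD (m : ℕ → ℕ → ℝ) (α : ℕ → ℝ) (n : ℕ) :
    C (pfD m α n) = indexPfaffian (borderedMoment m α (2 * n + 3)) (N := n + 1)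
      fun i => if (i : ℕ) = 2 * n + 1 then 2 * n + 2 else i := by
  have hv : (fun i : Fin (2 * (n + 1)) => if (i : ℕ) = 2 * n + 1 then 2 * n + 2 else (i : ℕ)) =
      fun i : Fin (2 * (n + 1)) => if (i : ℕ) = 0 then 0 else idxK n (i - 1) + 1 := by
    funext i
    simp only [idxK]
    split_ifs <;> omega
  have hne : ∀ i : Fin (2 * (n + 1)), idxK n (i - 1) + 1 ≠ 2 * n + 3 := fun i => by
    simp only [idxK]
    split_ifs <;> omega
  rw [pfD, pfaffian_map, hv]
  refine congrArg pfaffian (Matrix.ext fun i j => ?_)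
  by_cases hi : (i : ℕ) = 0 <;> by_cases hj : (j : ℕ) = 0 <;>
    simp only [Matrix.map_apply, Matrix.of_apply, borderedMoment, hi, hj, hne, if_true, if_false,
      Nat.add_one_ne_zero, Nat.add_sub_cancel, map_neg, map_zero]

theorem tauhat_smul_ptilde_even (m : ℕ → ℕ → ℝ) (α : ℕ → ℝ) (hne : ∀ k, tauhat m α k ≠ 0)
    {n L : ℕ} (hL : 2 * n + 1 < L) :
    tauhat m α (2 * n) • ptilde m α (2 * n) =
      indexPfaffian (borderedMoment m α L) (N := n + 1)
        fun i => if (i : ℕ) = 2 * n + 1 then L else i + 1 := by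
  rw [ptilde, if_pos (by omega), Nat.mul_div_cancel_left n two_pos, ptildeEven,
    smul_inv_smul₀ (hne _)]
  refine congrArg pfaffian (Matrix.ext fun i j => ?_)
  have := i.isLt
  have := j.isLt
  simp only [Matrix.of_apply, borderedMoment]
  split_ifs <;> first | omega | contradiction | simp

theorem tauhat_smul_pSkewOdd (m : ℕ → ℕ → ℝ) (α : ℕ → ℝ) (hne : ∀ k, tauhat m α k ≠ 0) (n : ℕ) :
    tauhat m α (2 * n) • pSkewOdd m α n =
      indexPfaffian (borderedMoment m α (2 * n + 3)) (N := n + 1)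
        fun i => if (i : ℕ) = 2 * n + 1 then 2 * n + 3
          else if (i : ℕ) = 2 * n then 2 * n + 2 else i + 1 := by
  rw [pSkewOdd, smul_inv_smul₀ (hne _)]
  refine congrArg pfaffian (Matrix.ext fun i j => ?_)
  have := i.isLt
  have := j.isLt
  simp only [Matrix.of_apply, borderedMoment, idxK]
  split_ifs <;> first | omega | contradiction | simp

theorem tauhat_smul_ptilde_odd (m : ℕ → ℕ → ℝ) (α : ℕ → ℝ) (hne : ∀ k, tauhat m α k ≠ 0)
    {n L : ℕ} (hL : 2 * n + 2 < L) :
    tauhat m α (2 * n + 1) • ptilde m α (2 * n + 1) =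
      indexPfaffian (borderedMoment m α L) (N := n + 2)
        fun i => if (i : ℕ) = 2 * n + 3 then L else i := by
  rw [ptilde, if_neg (by omega), show (2 * n + 1) / 2 = n by omega, ptildeOdd,
    smul_inv_smul₀ (hne _)]
  refine congrArg pfaffian (Matrix.ext fun i j => ?_)
  have := i.isLt
  have := j.isLt
  simp only [Matrix.of_apply, borderedMoment]
  split_ifs <;> first | omega | rfl

/-- The Plücker relation for lists built from `0, 1, …, 2n + 3`. -/
theorem indexPfaffian_pluecker_nat {R : Type*} [CommRing R] [Algebra ℚ R] (M : ℕ → ℕ → R)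
    (hM : ∀ a b, M a b = -M b a) (n : ℕ) :
    indexPfaffian M (N := n + 1)
          (fun i : Fin (2 * (n + 1)) => if (i : ℕ) = 2 * n + 1 then 2 * n + 3 else (i : ℕ)) *
        indexPfaffian M (N := n + 1) (fun i : Fin (2 * (n + 1)) => (i : ℕ) + 1) -
      indexPfaffian M (N := n + 1)
          (fun i : Fin (2 * (n + 1)) => if (i : ℕ) = 2 * n + 1 then 2 * n + 3 else (i : ℕ) + 1) *
        indexPfaffian M (N := n + 1)
          (fun i : Fin (2 * (n + 1)) => if (i : ℕ) = 2 * n + 1 then 2 * n + 2 else (i : ℕ)) +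
      indexPfaffian M (N := n + 1)
          (fun i : Fin (2 * (n + 1)) => if (i : ℕ) = 2 * n + 1 then 2 * n + 3
            else if (i : ℕ) = 2 * n then 2 * n + 2 else (i : ℕ) + 1) *
        indexPfaffian M (N := n + 1) (fun i : Fin (2 * (n + 1)) => (i : ℕ)) =
    indexPfaffian M (N := n) (fun i : Fin (2 * n) => (i : ℕ) + 1) *
      indexPfaffian M (N := n + 2)
        (fun i : Fin (2 * (n + 2)) => if (i : ℕ) = 2 * n + 3 then 2 * n + 3 else (i : ℕ)) := by
  let u : Fin (2 * n + 1) → ℕ := fun i => if (i : ℕ) = 2 * n then 2 * n + 3 else i + 1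
  let w : Fin (2 * (n + 1) + 1) → ℕ := fun i => i
  have h := indexPfaffian_pluecker M hM u w
  have hL : ∀ i : Fin (2 * n), indexPfaffian M (consIndex (w i.castSucc.castSucc.succ) u) = 0 :=
    fun i => by
      have : w i.castSucc.castSucc.succ = u i.castSucc := by
        simp [u, w, i.isLt.ne]
      rw [this, indexPfaffian_cons_mem]
  have hR : ∀ j : Fin (2 * n), indexPfaffian M (consIndex (u j.castSucc) w) = 0 := fun j => by
    have : u j.castSucc = w j.castSucc.castSucc.succ := by
      simp [u, w, j.isLt.ne]
    rw [this]
    exact indexPfaffian_cons_mem M w _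
  have hfront : consIndex 0 u = fun i : Fin (2 * (n + 1)) =>
      if (i : ℕ) = 2 * n + 1 then 2 * n + 3 else (i : ℕ) := by
    refine funext (Fin.cases (n := 2 * n + 1) ?_ fun i => ?_)
    · simp [consIndex]
    · simp [consIndex, u]
  have hmid : ∀ a, indexPfaffian M (consIndex a u) = indexPfaffian M (N := n + 1)
      (fun i : Fin (2 * (n + 1)) => if (i : ℕ) = 2 * n + 1 then 2 * n + 3
        else if (i : ℕ) = 2 * n then a else (i : ℕ) + 1) := fun a => by
    have := indexPfaffian_cons_removeNth M (fun i : Fin (2 * n + 2) =>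
      if (i : ℕ) = 2 * n + 1 then 2 * n + 3
        else if (i : ℕ) = 2 * n then a else (i : ℕ) + 1) ⟨2 * n, by omega⟩
    simp only [pow_mul, neg_one_sq, one_pow, one_mul] at this
    refine (congrArg (indexPfaffian M) (congrArg₂ consIndex ?_ ?_)).trans this
    · simp
    · funext i
      simp only [u, Function.comp_apply, Fin.succAbove, Fin.lt_def, Fin.val_castSucc]
      split_ifs <;> simp_all <;> omega
  have hback : indexPfaffian M (consIndex (2 * n + 3) w) = -indexPfaffian M (N := n + 2)
      (fun i : Fin (2 * (n + 2)) => if (i : ℕ) = 2 * n + 3 then 2 * n + 3 else (i : ℕ)) := by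
    have := indexPfaffian_cons_removeNth (N := n + 1) M
      (fun i => if (i : ℕ) = 2 * n + 3 then 2 * n + 3 else (i : ℕ)) (Fin.last (2 * n + 3))
    rw [Fin.val_last, (show Odd (2 * n + 3) from ⟨n + 1, by ring⟩).neg_one_pow,
      neg_one_mul] at this
    refine (congrArg (indexPfaffian M) (congrArg₂ consIndex ?_ ?_)).trans this
    · simp
    · refine funext fun i : Fin (2 * n + 3) => ?_
      have hi : (((Fin.last (2 * n + 3)).succAbove i : Fin (2 * n + 4)) : ℕ) = i := by
        rw [Fin.succAbove_last_apply, Fin.val_castSucc]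
      change (i : ℕ) = if (((Fin.last (2 * n + 3)).succAbove i : Fin (2 * n + 4)) : ℕ) = 2 * n + 3
        then 2 * n + 3 else (((Fin.last (2 * n + 3)).succAbove i : Fin (2 * n + 4)) : ℕ)
      rw [hi, if_neg i.isLt.ne]
  have hw0 : w ∘ Fin.succAbove 0 = fun i : Fin (2 * (n + 1)) => (i : ℕ) + 1 := by
    funext i
    simp [w]
  have hw1 : w ∘ (Fin.last (2 * n)).castSucc.succ.succAbove = fun i : Fin (2 * (n + 1)) =>
      if (i : ℕ) = 2 * n + 1 then 2 * n + 2 else (i : ℕ) := by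
    refine funext fun i : Fin (2 * n + 2) => ?_
    have := i.isLt
    simp only [w, Function.comp_apply, Fin.succAbove, Fin.lt_def, Fin.val_castSucc, Fin.val_succ,
      Fin.val_last]
    split_ifs <;> simp <;> omega
  have hw2 : w ∘ (Fin.last (2 * n + 1)).succ.succAbove = fun i : Fin (2 * (n + 1)) =>
      (i : ℕ) := by
    refine funext fun i : Fin (2 * n + 2) => ?_
    simp only [w, Function.comp_apply, Fin.succ_last, Fin.succAbove_last_apply, Fin.val_castSucc]
  have hu : u ∘ (Fin.last (2 * n)).succAbove = fun i : Fin (2 * n) => (i : ℕ) + 1 := by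
    funext i
    simp [u, i.isLt.ne]
  conv_rhs at h =>
    rw [Fin.sum_univ_castSucc (n := 2 * n),
      Finset.sum_eq_zero fun j _ => by rw [hR, mul_zero, mul_zero]]
  have hsum := (Fin.sum_univ_succ (n := 2 * n + 2) fun i => (-1) ^ (i : ℕ) *
    (indexPfaffian M (consIndex (w i) u) *
      indexPfaffian M (N := n + 1) (w ∘ i.succAbove))).symm.trans h
  rw [Fin.sum_univ_castSucc, Fin.sum_univ_castSucc,
    Finset.sum_eq_zero fun j _ => by rw [hL, zero_mul, mul_zero], hw0, hw1, hw2, hu] at hsum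
  have hwv0 : w 0 = 0 := rfl
  have hwv1 : w (Fin.last (2 * n)).castSucc.succ = 2 * n + 1 := rfl
  have hwv2 : w (Fin.last (2 * n + 1)).succ = 2 * n + 2 := rfl
  have huv : u (Fin.last (2 * n)) = 2 * n + 3 := if_pos rfl
  have hmid1 : (fun i : Fin (2 * (n + 1)) => if (i : ℕ) = 2 * n + 1 then 2 * n + 3
        else if (i : ℕ) = 2 * n then 2 * n + 1 else (i : ℕ) + 1) =
      fun i : Fin (2 * (n + 1)) =>
        if (i : ℕ) = 2 * n + 1 then 2 * n + 3 else (i : ℕ) + 1 := by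
    funext i
    split_ifs <;> omega
  rw [hwv0, hwv1, hwv2, huv, hfront, hmid, hmid, hmid1, hback] at hsum
  simp only [Fin.val_zero, Fin.val_succ, Fin.val_castSucc, Fin.val_last, pow_succ, pow_mul] at hsum
  linear_combination hsum

/-- Proposition 4.3 of the paper: for `n ≥ 1`,
`P_{2n+1} = P̃_{2n+1} + a_n·P̃_{2n} + b_n·P̃_{2n−1}` with
`a_n = Pf(D⁽ⁿ⁾)/τ̂_{2n+1}` and `b_n = −τ̂_{2n+2}·τ̂_{2n−1}/(τ̂_{2n}·τ̂_{2n+1})`. -/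
theorem stmt11 (m : ℕ → ℕ → ℝ) (α : ℕ → ℝ)
    (hskew : ∀ i j, m i j = -m j i)
    (hne : ∀ k, tauhat m α k ≠ 0) :
    ∀ n : ℕ, 1 ≤ n →
      pSkewOdd m α n =
        ptilde m α (2 * n + 1) +
          (pfD m α n / tauhat m α (2 * n + 1)) • ptilde m α (2 * n) +
          (-(tauhat m α (2 * n + 2) * tauhat m α (2 * n - 1)) /
            (tauhat m α (2 * n) * tauhat m α (2 * n + 1))) • ptilde m α (2 * n - 1) := by
  intro n hn
  obtain ⟨k, rfl⟩ : ∃ k, n = k + 1 := ⟨n - 1, by omega⟩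
  have h := indexPfaffian_pluecker_nat (borderedMoment m α (2 * (k + 1) + 3))
    (borderedMoment_skew m α hskew _) (k + 1)
  have hF := tauhat_smul_ptilde_odd m α hne (n := k) (L := 2 * (k + 1) + 3) (by omega)
  have hO := tauhat_smul_ptilde_odd m α hne (n := k + 1) (L := 2 * (k + 1) + 3) (by omega)
  have hE := tauhat_smul_ptilde_even m α hne (n := k + 1) (L := 2 * (k + 1) + 3) (by omega)
  have h0 := C_tauhat_even m α (n := k + 1) (L := 2 * (k + 1) + 3) (by omega)
  have h1 := C_tauhat_odd m α (n := k + 1) (L := 2 * (k + 1) + 3) (by omega)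
  have h2 := C_tauhat_even m α (n := k + 1 + 1) (L := 2 * (k + 1) + 3) (by omega)
  have key : (tauhat m α (2 * k + 1) • ptilde m α (2 * k + 1)) *
        C (tauhat m α (2 * (k + 1 + 1))) -
      (tauhat m α (2 * (k + 1)) • ptilde m α (2 * (k + 1))) * C (pfD m α (k + 1)) +
      (tauhat m α (2 * (k + 1)) • pSkewOdd m α (k + 1)) * C (tauhat m α (2 * (k + 1) + 1)) =
      C (tauhat m α (2 * (k + 1))) *
        (tauhat m α (2 * (k + 1) + 1) • ptilde m α (2 * (k + 1) + 1)) := by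
    rw [hF, hO, hE, tauhat_smul_pSkewOdd m α hne, h0, h1, h2, C_pfD]
    exact h
  rw [show 2 * (k + 1) + 2 = 2 * (k + 1 + 1) by ring, show 2 * (k + 1) - 1 = 2 * k + 1 by omega]
  have ht0 := hne (2 * (k + 1))
  have ht1 := hne (2 * (k + 1) + 1)
  refine smul_right_injective _ (mul_ne_zero ht0 ht1) ?_
  simp only [smul_add, smul_smul]
  rw [mul_div_cancel₀ _ (mul_ne_zero ht0 ht1), mul_assoc _ _ (pfD m α (k + 1) / _),
    mul_div_cancel₀ _ ht1]
  simp only [smul_eq_C_mul, map_mul, map_neg] at key ⊢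
  linear_combination key
end

section
/- Let m_{i,j} : ℝ → ℝ and α_i : ℝ → ℝ (i, j ∈ ℕ) be differentiable functions of t with m_{i,j} = −m_{j,i}, m_{i,j}′ = m_{i+1,j} + m_{i,j+1}, and α_i′ = α_{i+1} for all i, j. Define τ̂_{2n}(t) = Pf((m_{i,j}(t))_{i,j=0}^{2n−1}) and τ̂_{2n+1}(t) = Pf of the matrix (m_{i,j}(t))_{i,j=0}^{2n} bordered by the row (α_0(t), …, α_{2n}(t)). Then for all n ≥ 1 and all t: (a) τ̂_{2n}′(t) = Pf(B⁽ⁿ⁾(t)), where B⁽ⁿ⁾ is the 2n×2n skew-symmetric matrix with entries m_{i_k,i_l}(t) for the index list (0, 1, …, 2n−2, 2n); and (b) for all n ≥ 0, τ̂_{2n+1}′(t) = Pf(C⁽ⁿ⁾(t)), where C⁽ⁿ⁾ is the (2n+2)×(2n+2) skew-symmetric matrix with entries m_{i_k,i_l}(t) for the index list (0, 1, …, 2n−1, 2n+1), bordered by a first row with entries α_{i_k}(t). -/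
/-- `τ̂_{2n}(t) = Pf((m_{i,j}(t))_{i,j=0}^{2n−1})`. -/
noncomputable def tauEvenT (m : ℕ → ℕ → ℝ → ℝ) (n : ℕ) : ℝ → ℝ :=
  fun t => pfaffian (Matrix.of fun i j : Fin (2 * n) => m i j t)

/-- `τ̂_{2n+1}(t) = Pf` of `(m_{i,j}(t))_{i,j=0}^{2n}` bordered by the row
`(α_0(t), …, α_{2n}(t))`. -/
noncomputable def tauOddT (m : ℕ → ℕ → ℝ → ℝ) (α : ℕ → ℝ → ℝ) (n : ℕ) : ℝ → ℝ :=
  fun t => pfaffian (Matrix.of fun i j : Fin (2 * (n + 1)) =>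
    if (i : ℕ) = 0 then (if (j : ℕ) = 0 then 0 else α ((j : ℕ) - 1) t)
    else if (j : ℕ) = 0 then -α ((i : ℕ) - 1) t
    else m ((i : ℕ) - 1) ((j : ℕ) - 1) t)

theorem Fin.sum_univ_two_mul {M : Type*} [AddCommMonoid M] {N : ℕ} (f : Fin (2 * N) → M) :
    ∑ q, f q = ∑ k : Fin N, (f ⟨2 * (k : ℕ), by have := k.isLt; omega⟩ +
      f ⟨2 * (k : ℕ) + 1, by have := k.isLt; omega⟩) := by
  induction N with
  | zero => simp
  | succ N ih =>
    rw [Fin.sum_univ_castSucc (n := N)]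
    have h := ih fun q => f ⟨q, by have := q.isLt; omega⟩
    calc ∑ q, f q = ∑ q : Fin (2 * N + 1 + 1), f q := rfl
      _ = _ := by
        rw [Fin.sum_univ_castSucc, Fin.sum_univ_castSucc, add_assoc]
        exact congrArg₂ (· + ·) h rfl

/-- The Pfaffian sum vanishes when two distinct indices play the same role. -/
theorem pfaffian_eq_zero_of_submatrix_swap {N : ℕ} (A : Matrix (Fin (2 * N)) (Fin (2 * N)) ℝ)
    {p q : Fin (2 * N)} (hpq : p ≠ q)
    (hA : ∀ i j, A (Equiv.swap p q i) (Equiv.swap p q j) = A i j) : pfaffian A = 0 := by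
  unfold pfaffian
  refine mul_eq_zero_of_right _ (self_eq_neg.mp ?_)
  rw [← Finset.sum_neg_distrib]
  refine Fintype.sum_equiv (Equiv.mulLeft (Equiv.swap p q)) _ _ fun π => ?_
  simp [Equiv.Perm.sign_swap hpq, hA]

/-- The Leibniz rule for the Pfaffian of a matrix of functions, when differentiation acts on the
entries through the weighted index shift `i ↦ c i • (i + 1)`. -/
theorem hasDerivAt_pfaffian_of_shift (G : ℕ → ℕ → ℝ → ℝ) (c : ℕ → ℝ)
    (hG : ∀ i j t, HasDerivAt (G i j) (c i * G (i + 1) j t + c j * G i (j + 1) t) t)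
    (N : ℕ) (t : ℝ) :
    HasDerivAt (fun s => pfaffian (Matrix.of fun i j : Fin (2 * N) => G i j s))
      (∑ p : Fin (2 * N), c p * pfaffian (Matrix.of fun i j : Fin (2 * N) =>
        G (if i = p then (i : ℕ) + 1 else i) (if j = p then (j : ℕ) + 1 else j) t)) t := by
  have key (π : Equiv.Perm (Fin (2 * N))) :
      HasDerivAt (fun s => ∏ k : Fin N, G (π ⟨2 * (k : ℕ), by have := k.isLt; omega⟩)
          (π ⟨2 * (k : ℕ) + 1, by have := k.isLt; omega⟩) s)
        (∑ p : Fin (2 * N), c p * ∏ k : Fin N,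
          (Matrix.of fun i j : Fin (2 * N) =>
            G (if i = p then (i : ℕ) + 1 else i) (if j = p then (j : ℕ) + 1 else j) t)
            (π ⟨2 * (k : ℕ), by have := k.isLt; omega⟩)
            (π ⟨2 * (k : ℕ) + 1, by have := k.isLt; omega⟩)) t := by
    refine (HasDerivAt.fun_finsetProd fun k _ => hG _ _ t).congr_deriv ?_
    rw [← Equiv.sum_comp π, Fin.sum_univ_two_mul]
    refine Finset.sum_congr rfl fun k _ => ?_
    rw [← Finset.mul_prod_erase _ _ (Finset.mem_univ k),
      ← Finset.mul_prod_erase _ _ (Finset.mem_univ k)]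
    have hoff (q : Fin (2 * N)) (hq : (q : ℕ) / 2 = k) :
        ∏ l ∈ Finset.univ.erase k, (Matrix.of fun i j : Fin (2 * N) =>
            G (if i = π q then (i : ℕ) + 1 else i) (if j = π q then (j : ℕ) + 1 else j) t)
            (π ⟨2 * (l : ℕ), by have := l.isLt; omega⟩)
            (π ⟨2 * (l : ℕ) + 1, by have := l.isLt; omega⟩) =
          ∏ l ∈ Finset.univ.erase k, G (π ⟨2 * (l : ℕ), by have := l.isLt; omega⟩)
            (π ⟨2 * (l : ℕ) + 1, by have := l.isLt; omega⟩) t := by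
      refine Finset.prod_congr rfl fun l hl => ?_
      have hlk : (l : ℕ) ≠ k := fun h => Finset.ne_of_mem_erase hl (Fin.ext h)
      rw [Matrix.of_apply, if_neg, if_neg]
      all_goals
        rw [π.injective.eq_iff, Fin.ext_iff]
        dsimp only
        omega
    rw [hoff _ (by dsimp only; omega), hoff _ (by dsimp only; omega)]
    simp only [Matrix.of_apply, π.injective.eq_iff, Fin.mk.injEq, smul_eq_mul, if_true,
      Nat.succ_ne_self, (Nat.succ_ne_self _).symm, if_false]
    ring
  unfold pfaffian
  refine ((HasDerivAt.fun_sum fun π _ => (key π).const_smul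
    (Equiv.Perm.sign π : ℤ)).const_mul _).congr_deriv ?_
  simp only [Finset.mul_sum, Finset.smul_sum]
  rw [Finset.sum_comm]
  refine Finset.sum_congr rfl fun p _ => Finset.sum_congr rfl fun π _ => ?_
  simp only [zsmul_eq_mul]
  ring

/-- Under a weighted index shift, only the shift of the last index contributes to the derivative
of the Pfaffian. -/
theorem hasDerivAt_pfaffian_of_shift_last (G : ℕ → ℕ → ℝ → ℝ) (c : ℕ → ℝ)
    (hG : ∀ i j t, HasDerivAt (G i j) (c i * G (i + 1) j t + c j * G i (j + 1) t) t)
    {N : ℕ} (hN : 1 ≤ N) (hc : c (2 * N - 1) = 1) (t : ℝ) :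
    HasDerivAt (fun s => pfaffian (Matrix.of fun i j : Fin (2 * N) => G i j s))
      (pfaffian (Matrix.of fun i j : Fin (2 * N) =>
        G (if (i : ℕ) = 2 * N - 1 then 2 * N else i)
          (if (j : ℕ) = 2 * N - 1 then 2 * N else j) t)) t := by
  refine (hasDerivAt_pfaffian_of_shift G c hG N t).congr_deriv ?_
  have hlast : 2 * N - 1 < 2 * N := by omega
  rw [Finset.sum_eq_single ⟨2 * N - 1, hlast⟩]
  · rw [hc, one_mul]
    have h (i : Fin (2 * N)) : (if i = ⟨2 * N - 1, hlast⟩ then (i : ℕ) + 1 else i) =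
        if (i : ℕ) = 2 * N - 1 then 2 * N else i := by
      simp only [Fin.ext_iff]
      split_ifs <;> omega
    simp only [h]
  · intro p _ hp
    have hp' : (p : ℕ) + 1 < 2 * N := by
      have := p.isLt
      have : (p : ℕ) ≠ 2 * N - 1 := fun h => hp (Fin.ext h)
      omega
    refine mul_eq_zero_of_right _ (pfaffian_eq_zero_of_submatrix_swap _
      (p := p) (q := ⟨p + 1, hp'⟩) (by simp [Fin.ext_iff]) fun i j => ?_)
    have h (i : Fin (2 * N)) :
        (if Equiv.swap p ⟨p + 1, hp'⟩ i = p then (Equiv.swap p ⟨p + 1, hp'⟩ i : ℕ) + 1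
          else Equiv.swap p ⟨p + 1, hp'⟩ i) = if i = p then (i : ℕ) + 1 else i := by
      rw [Equiv.swap_apply_def]
      simp only [Fin.ext_iff]
      split_ifs <;> simp_all [Fin.ext_iff]
    simp only [Matrix.of_apply, h]
  · simp

/-- under the evolutions `∂ₜ m_{i,j} = m_{i+1,j} + m_{i,j+1}` and
`∂ₜ α_i = α_{i+1}`, (a) `τ̂_{2n}′ = Pf(0,…,2n−2,2n)` (for `n ≥ 1`), and
(b) `τ̂_{2n+1}′ = Pf(d₀,0,…,2n−1,2n+1)` (for all `n ≥ 0`). -/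
theorem stmt12 (m : ℕ → ℕ → ℝ → ℝ) (α : ℕ → ℝ → ℝ)
    (hskew : ∀ i j t, m i j t = -m j i t)
    (hmdiff : ∀ i j, Differentiable ℝ (m i j))
    (hmder : ∀ i j t, deriv (m i j) t = m (i + 1) j t + m i (j + 1) t)
    (hαdiff : ∀ i, Differentiable ℝ (α i))
    (hαder : ∀ i t, deriv (α i) t = α (i + 1) t) :
    (∀ n : ℕ, 1 ≤ n → ∀ t : ℝ,
      deriv (tauEvenT m n) t =
        pfaffian (Matrix.of fun i j : Fin (2 * n) =>
          m (if (i : ℕ) = 2 * n - 1 then 2 * n else (i : ℕ))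
            (if (j : ℕ) = 2 * n - 1 then 2 * n else (j : ℕ)) t)) ∧
    (∀ n : ℕ, ∀ t : ℝ,
      deriv (tauOddT m α n) t =
        pfaffian (Matrix.of fun i j : Fin (2 * (n + 1)) =>
          if (i : ℕ) = 0 then
            (if (j : ℕ) = 0 then 0
             else α (if (j : ℕ) - 1 = 2 * n then 2 * n + 1 else (j : ℕ) - 1) t)
          else if (j : ℕ) = 0 then
            -α (if (i : ℕ) - 1 = 2 * n then 2 * n + 1 else (i : ℕ) - 1) t
          else m (if (i : ℕ) - 1 = 2 * n then 2 * n + 1 else (i : ℕ) - 1)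
            (if (j : ℕ) - 1 = 2 * n then 2 * n + 1 else (j : ℕ) - 1) t)) := by
  have hm (i j t) : HasDerivAt (m i j) (m (i + 1) j t + m i (j + 1) t) t :=
    hmder i j t ▸ (hmdiff i j t).hasDerivAt
  have hα (i t) : HasDerivAt (α i) (α (i + 1) t) t := hαder i t ▸ (hαdiff i t).hasDerivAt
  constructor
  · intro n hn t
    exact (hasDerivAt_pfaffian_of_shift_last m 1 (by simpa using hm) hn rfl t).deriv
  · intro n t
    let G : ℕ → ℕ → ℝ → ℝ := fun i j t =>
      if i = 0 then (if j = 0 then 0 else α (j - 1) t)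
      else if j = 0 then -α (i - 1) t
      else m (i - 1) (j - 1) t
    have hG (i j t) : HasDerivAt (G i j)
        ((if i = 0 then 0 else 1) * G (i + 1) j t + (if j = 0 then 0 else 1) * G i (j + 1) t)
        t := by
      rcases i with _ | i <;> rcases j with _ | j
      · simpa [G] using hasDerivAt_const t (0 : ℝ)
      · simpa [G] using hα j t
      · simpa [G] using (hα i t).fun_neg
      · simpa [G] using hm i j t
    refine (hasDerivAt_pfaffian_of_shift_last G (fun i => if i = 0 then 0 else 1) hG
      (N := n + 1) (by omega) (if_neg (show 2 * (n + 1) - 1 ≠ 0 by omega)) t).deriv.trans ?_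
    congr 1
    ext i j
    have hzero (i : ℕ) : (if i = 2 * (n + 1) - 1 then 2 * (n + 1) else i) = 0 ↔ i = 0 := by
      by_cases hi : i = 2 * (n + 1) - 1
      · rw [if_pos hi]
        omega
      · rw [if_neg hi]
    have hpred (i : ℕ) (hi : i ≠ 0) : (if i = 2 * (n + 1) - 1 then 2 * (n + 1) else i) - 1 =
        if i - 1 = 2 * n then 2 * n + 1 else i - 1 := by
      split_ifs <;> omega
    simp only [Matrix.of_apply, G, hzero]
    by_cases hi : (i : ℕ) = 0 <;> by_cases hj : (j : ℕ) = 0 <;>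
      simp only [hi, hj, if_true, if_false]
    · rw [hpred _ hj]
    · rw [hpred _ hi]
    · rw [hpred _ hi, hpred _ hj]
end

section
/- Let m_{i,j} ∈ ℝ (i, j ∈ ℕ) with m_{i,j} = −m_{j,i} and α_i ∈ ℝ (i ∈ ℕ) satisfy the rank two shift condition m_{i+1,j} + m_{i,j+1} = α_{i+1}·α_j − α_i·α_{j+1} for all i, j ∈ ℕ. Then for every n ∈ ℕ the following two Pfaffians are equal: Pf(C⁽ⁿ⁾) = Pf(E⁽ⁿ⁾), where C⁽ⁿ⁾ is the (2n+2)×(2n+2) skew-symmetric matrix with entries m_{i_k,i_l} for the index list (0, 1, …, 2n−1, 2n+1), bordered by a first row with entries α_{i_k}, and E⁽ⁿ⁾ is the (2n+2)×(2n+2) skew-symmetric matrix with entries m_{k,l} for 0 ≤ k, l ≤ 2n, bordered by a first row with entries α_{k+1} (k = 0, …, 2n). -/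
/-- The index list `(0, 1, …, 2n−1, 2n+1)`. -/
def idxC (n k : ℕ) : ℕ := if k = 2 * n then 2 * n + 1 else k

/-- The first position of the `k`-th consecutive pair in `Fin (2 * N)`. -/
def pairFst {N : ℕ} (k : Fin N) : Fin (2 * N) := ⟨2 * (k : ℕ), by have := k.isLt; omega⟩

/-- The second position of the `k`-th consecutive pair in `Fin (2 * N)`. -/
def pairSnd {N : ℕ} (k : Fin N) : Fin (2 * N) := ⟨2 * (k : ℕ) + 1, by have := k.isLt; omega⟩

theorem pairFst_ne_pairSnd {N : ℕ} (k l : Fin N) : pairFst k ≠ pairSnd l := by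
  simp only [pairFst, pairSnd, ne_eq, Fin.mk.injEq]; omega

theorem pairFst_inj {N : ℕ} {k l : Fin N} : pairFst k = pairFst l ↔ k = l := by
  simp only [pairFst, Fin.ext_iff]; omega

theorem pairSnd_inj {N : ℕ} {k l : Fin N} : pairSnd k = pairSnd l ↔ k = l := by
  simp only [pairSnd, Fin.ext_iff]; omega

theorem exists_pair {N : ℕ} (j : Fin (2 * N)) : ∃ k, j = pairFst k ∨ j = pairSnd k := by
  have := j.isLt
  refine ⟨⟨(j : ℕ) / 2, by omega⟩, ?_⟩
  simp only [pairFst, pairSnd, Fin.ext_iff]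
  omega

theorem sum_eq_sum_pairs {M : Type*} [AddCommMonoid M] {N : ℕ} (F : Fin (2 * N) → M) :
    ∑ j, F j = ∑ k, (F (pairFst k) + F (pairSnd k)) := by
  induction N with
  | zero => rfl
  | succ N ih =>
    rw [Fin.sum_univ_castSucc (n := N)]
    change ∑ j : Fin (2 * N + 1 + 1), F j = _
    rw [Fin.sum_univ_castSucc, Fin.sum_univ_castSucc, add_assoc]
    congr 1
    exact ih fun j => F j.castSucc.castSucc

/-- The signed sum over permutations in the Pfaffian of the matrix `b (f i) (f j)`. -/
def pfaffianSum {ι R : Type*} [CommRing R] {N : ℕ} (b : ι → ι → R) (f : Fin (2 * N) → ι) : R :=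
  ∑ π : Equiv.Perm (Fin (2 * N)), (Equiv.Perm.sign π : ℤ) •
    ∏ k : Fin N, b (f (π (pairFst k))) (f (π (pairSnd k)))

theorem pfaffian_of_eq {ι R : Type*} [CommRing R] [Algebra ℚ R] {N : ℕ} (b : ι → ι → R)
    (f : Fin (2 * N) → ι) :
    pfaffian (Matrix.of fun i j => b (f i) (f j)) =
      algebraMap ℚ R (1 / (2 ^ N * N.factorial : ℚ)) * pfaffianSum b f := rfl

theorem pfaffianSum_eq_zero_of_eq {ι : Type*} {N : ℕ} (b : ι → ι → ℝ) (f : Fin (2 * N) → ι)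
    {i j : Fin (2 * N)} (hij : i ≠ j) (hf : f i = f j) : pfaffianSum b f = 0 := by
  have hswap : ∀ x, f (Equiv.swap i j x) = f x := by
    intro x
    rcases eq_or_ne x i with rfl | hi
    · rw [Equiv.swap_apply_left, hf]
    rcases eq_or_ne x j with rfl | hj
    · rw [Equiv.swap_apply_right, hf]
    rw [Equiv.swap_apply_of_ne_of_ne hi hj]
  have h : pfaffianSum b f = -pfaffianSum b f := by
    unfold pfaffianSum
    conv_lhs => rw [← Equiv.sum_comp (Equiv.mulLeft (Equiv.swap i j))]
    rw [← Finset.sum_neg_distrib]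
    refine Finset.sum_congr rfl fun π _ => ?_
    simp [Equiv.Perm.sign_mul, Equiv.Perm.sign_swap hij, hswap]
  linarith

theorem prod_update_pairFst {ι R : Type*} [CommRing R] {N : ℕ} (b : ι → ι → R)
    (g : Fin (2 * N) → ι) (l : Fin N) (u : ι) :
    ∏ k, b (Function.update g (pairFst l) u (pairFst k))
        (Function.update g (pairFst l) u (pairSnd k)) =
      b u (g (pairSnd l)) * ∏ k ∈ Finset.univ.erase l, b (g (pairFst k)) (g (pairSnd k)) := by
  rw [← Finset.mul_prod_erase _ _ (Finset.mem_univ l)]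
  congr 1
  · rw [Function.update_self, Function.update_of_ne (pairFst_ne_pairSnd _ _).symm]
  · refine Finset.prod_congr rfl fun k hk => ?_
    rw [Function.update_of_ne (pairFst_inj.not.mpr (Finset.ne_of_mem_erase hk)),
      Function.update_of_ne (pairFst_ne_pairSnd _ _).symm]

theorem prod_update_pairSnd {ι R : Type*} [CommRing R] {N : ℕ} (b : ι → ι → R)
    (g : Fin (2 * N) → ι) (l : Fin N) (u : ι) :
    ∏ k, b (Function.update g (pairSnd l) u (pairFst k))
        (Function.update g (pairSnd l) u (pairSnd k)) =
      b (g (pairFst l)) u * ∏ k ∈ Finset.univ.erase l, b (g (pairFst k)) (g (pairSnd k)) := by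
  rw [← Finset.mul_prod_erase _ _ (Finset.mem_univ l)]
  congr 1
  · rw [Function.update_self, Function.update_of_ne (pairFst_ne_pairSnd _ _)]
  · refine Finset.prod_congr rfl fun k hk => ?_
    rw [Function.update_of_ne (pairSnd_inj.not.mpr (Finset.ne_of_mem_erase hk)),
      Function.update_of_ne (pairFst_ne_pairSnd _ _)]

/-- Leibniz rule: letting the operator `x ↦ c x • s x - d x • o` act on each index of a Pfaffian in
turn amounts to differentiating each factor of the products. -/
theorem sum_pfaffianSum_update {ι R : Type*} [CommRing R] {N : ℕ} (b : ι → ι → R) (c d : ι → R)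
    (s : ι → ι) (o : ι) (f : Fin (2 * N) → ι) :
    ∑ j, (c (f j) * pfaffianSum b (Function.update f j (s (f j))) -
        d (f j) * pfaffianSum b (Function.update f j o)) =
      ∑ π : Equiv.Perm (Fin (2 * N)), (Equiv.Perm.sign π : ℤ) •
        ∑ l, (c (f (π (pairFst l))) * b (s (f (π (pairFst l)))) (f (π (pairSnd l))) -
            d (f (π (pairFst l))) * b o (f (π (pairSnd l))) +
            (c (f (π (pairSnd l))) * b (f (π (pairFst l))) (s (f (π (pairSnd l)))) -
            d (f (π (pairSnd l))) * b (f (π (pairFst l))) o)) *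
          ∏ k ∈ Finset.univ.erase l, b (f (π (pairFst k))) (f (π (pairSnd k))) := by
  simp only [pfaffianSum, Finset.mul_sum, ← Finset.sum_sub_distrib]
  rw [Finset.sum_comm]
  refine Finset.sum_congr rfl fun π _ => ?_
  simp only [mul_smul_comm, ← smul_sub, ← Finset.smul_sum]
  congr 1
  rw [← Equiv.sum_comp π, sum_eq_sum_pairs]
  refine Finset.sum_congr rfl fun l _ => ?_
  have hupd : ∀ j u x, Function.update f (π j) u (π x) = Function.update (f ∘ π) j u x := by
    intro j u x
    simp [Function.update_apply]
  simp only [hupd, prod_update_pairFst, prod_update_pairSnd, Function.comp_apply]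
  ring

/-- If exactly one index equals `o`, and `C` vanishes off `o`, then only one term survives in the
derivative of the product. -/
theorem prod_eq_sum_of_unique {ι R : Type*} [CommRing R] {N : ℕ} (b b' C : ι → ι → R) (o : ι)
    (hC : ∀ x y, x ≠ o → y ≠ o → C x y = 0) (hb : ∀ x y, x ≠ o → y ≠ o → b' x y = b x y)
    (hl : ∀ y, b' o y = C o y) (hr : ∀ x, b' x o = C x o)
    (g : Fin (2 * N) → ι) (j : Fin (2 * N)) (hj : g j = o) (hu : ∀ i, i ≠ j → g i ≠ o) :
    ∏ k, b' (g (pairFst k)) (g (pairSnd k)) =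
      ∑ l, C (g (pairFst l)) (g (pairSnd l)) *
        ∏ k ∈ Finset.univ.erase l, b (g (pairFst k)) (g (pairSnd k)) := by
  obtain ⟨l, hlj⟩ := exists_pair j
  have hoff : ∀ k, k ≠ l → g (pairFst k) ≠ o ∧ g (pairSnd k) ≠ o := by
    intro k hk
    rcases hlj with rfl | rfl
    · exact ⟨hu _ (pairFst_inj.not.mpr hk), hu _ (pairFst_ne_pairSnd _ _).symm⟩
    · exact ⟨hu _ (pairFst_ne_pairSnd _ _), hu _ (pairSnd_inj.not.mpr hk)⟩
  rw [Finset.sum_eq_single l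
    (fun k _ hk => by rw [hC _ _ (hoff k hk).1 (hoff k hk).2, zero_mul]) (by simp),
    ← Finset.mul_prod_erase _ _ (Finset.mem_univ l)]
  congr 1
  · rcases hlj with rfl | rfl
    · rw [hj, hl]
    · rw [hj, hr]
  · exact Finset.prod_congr rfl fun k hk =>
      hb _ _ (hoff k (Finset.ne_of_mem_erase hk)).1 (hoff k (Finset.ne_of_mem_erase hk)).2

/-- The entries `m i j` bordered by a row `a` at the extra index `none`. -/
def borderedEntry (m : ℕ → ℕ → ℝ) (a : ℕ → ℝ) : Option ℕ → Option ℕ → ℝ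
  | none, none => 0
  | none, some j => a j
  | some i, none => -a i
  | some i, some j => m i j

/-- The index list `none, 0, 1, …`. -/
def borderedIndex (N : ℕ) (i : Fin N) : Option ℕ :=
  if (i : ℕ) = 0 then none else some ((i : ℕ) - 1)

theorem pfaffianSum_update_last_eq (m : ℕ → ℕ → ℝ) (α : ℕ → ℝ)
    (hrank2 : ∀ i j, m (i + 1) j + m i (j + 1) = α (i + 1) * α j - α i * α (j + 1)) (n : ℕ) :
    pfaffianSum (borderedEntry m α) (Function.update (borderedIndex (2 * (n + 1)))
        ⟨2 * n + 1, by omega⟩ (some (2 * n + 1))) =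
      pfaffianSum (borderedEntry m fun i => α (i + 1)) (borderedIndex (2 * (n + 1))) := by
  set f := borderedIndex (2 * (n + 1)) with hf
  let c : Option ℕ → ℝ := fun x => x.elim 0 fun _ => 1
  let d : Option ℕ → ℝ := fun x => x.elim 0 fun i => α (i + 1)
  let s : Option ℕ → Option ℕ := Option.map (· + 1)
  have hf0 : f 0 = none := by simp [hf, borderedIndex]
  have hfs : ∀ j, j ≠ 0 → f j = some ((j : ℕ) - 1) := by
    intro j hj
    have : (j : ℕ) ≠ 0 := fun h => hj (Fin.ext h)
    simp [hf, borderedIndex, this]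
  have key := sum_pfaffianSum_update (borderedEntry m α) c d s none f
  have hzero : ∀ j, j ≠ 0 → pfaffianSum (borderedEntry m α) (Function.update f j none) = 0 := by
    intro j hj
    apply pfaffianSum_eq_zero_of_eq _ _ hj
    rw [Function.update_self, Function.update_of_ne hj.symm, hf0]
  rw [Finset.sum_eq_single ⟨2 * n + 1, by omega⟩ ?_ (by simp)] at key
  · have hlast : f ⟨2 * n + 1, by omega⟩ = some (2 * n) := by
      rw [hfs _ (by simp [Fin.ext_iff])]; simp
    rw [hzero _ (by simp [Fin.ext_iff]), hlast] at key
    simp only [c, s, Option.elim_some, one_mul, mul_zero, sub_zero, Option.map_some] at key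
    rw [key, pfaffianSum]
    refine Finset.sum_congr rfl fun π _ => ?_
    congr 1
    symm
    refine prod_eq_sum_of_unique (borderedEntry m α) (borderedEntry m fun i => α (i + 1))
      (fun x y => c x * borderedEntry m α (s x) y - d x * borderedEntry m α none y +
        (c y * borderedEntry m α x (s y) - d y * borderedEntry m α x none))
      none ?_ ?_ ?_ ?_ (f ∘ π) (π⁻¹ 0) (by simp [hf0]) ?_
    · rintro (_ | i) (_ | j) hx hy <;> try contradiction
      have := hrank2 i j
      simp only [c, d, s, borderedEntry, Option.elim_some, Option.map_some]
      linarith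
    · rintro (_ | i) (_ | j) hx hy <;> first | contradiction | rfl
    · rintro (_ | j) <;> simp [c, d, s, borderedEntry]
    · rintro (_ | i) <;> simp [c, d, s, borderedEntry]
    · intro i hi
      have : π i ≠ 0 := fun h => hi (by rw [← h]; simp)
      simp [hfs _ this]
  · intro j _ hj
    rcases eq_or_ne j 0 with rfl | h0
    · simp [hf0, c, d]
    have hj' : (j : ℕ) < 2 * n + 1 := by
      have := j.isLt
      have : (j : ℕ) ≠ 2 * n + 1 := fun h => hj (Fin.ext h)
      omega
    have h0' : (j : ℕ) ≠ 0 := fun h => h0 (Fin.ext h)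
    have hrep : pfaffianSum (borderedEntry m α) (Function.update f j (s (f j))) = 0 := by
      have hne : j ≠ ⟨(j : ℕ) + 1, by omega⟩ := fun h => by
        have := congrArg Fin.val h
        simp at this
      apply pfaffianSum_eq_zero_of_eq _ _ hne
      rw [Function.update_self, Function.update_of_ne hne.symm, hfs j h0,
        hfs ⟨(j : ℕ) + 1, by omega⟩ (Fin.ne_of_val_ne (Nat.succ_ne_zero _))]
      simp only [s, Option.map_some, Option.some.injEq]
      omega
    rw [hrep, hzero j h0]
    simp

/-- under the rank two shift condition
`m_{i+1,j} + m_{i,j+1} = α_{i+1}α_j − α_iα_{j+1}`, one has the Pfaffian identity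
`Pf(d₀, 0, …, 2n−1, 2n+1) = Pf(d₁, 0, …, 2n)`, where `Pf(d₀,i) = α_i` and
`Pf(d₁,i) = α_{i+1}`. -/
theorem stmt13 (m : ℕ → ℕ → ℝ) (α : ℕ → ℝ)
    (hskew : ∀ i j, m i j = -m j i)
    (hrank2 : ∀ i j, m (i + 1) j + m i (j + 1) = α (i + 1) * α j - α i * α (j + 1)) :
    ∀ n : ℕ,
      pfaffian (Matrix.of fun i j : Fin (2 * (n + 1)) =>
        if (i : ℕ) = 0 then (if (j : ℕ) = 0 then 0 else α (idxC n ((j : ℕ) - 1)))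
        else if (j : ℕ) = 0 then -α (idxC n ((i : ℕ) - 1))
        else m (idxC n ((i : ℕ) - 1)) (idxC n ((j : ℕ) - 1))) =
      pfaffian (Matrix.of fun i j : Fin (2 * (n + 1)) =>
        if (i : ℕ) = 0 then (if (j : ℕ) = 0 then 0 else α ((j : ℕ) - 1 + 1))
        else if (j : ℕ) = 0 then -α ((i : ℕ) - 1 + 1)
        else m ((i : ℕ) - 1) ((j : ℕ) - 1)) := by
  intro n
  have key := congrArg
    (fun x => algebraMap ℚ ℝ (1 / (2 ^ (n + 1) * (n + 1).factorial : ℚ)) * x)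
    (pfaffianSum_update_last_eq m α hrank2 n)
  simp only [← pfaffian_of_eq] at key
  convert key using 3
  · ext i j
    have hidx : ∀ i : Fin (2 * (n + 1)), Function.update (borderedIndex (2 * (n + 1)))
        ⟨2 * n + 1, by omega⟩ (some (2 * n + 1)) i =
        if (i : ℕ) = 0 then none else some (idxC n ((i : ℕ) - 1)) := by
      intro i
      rw [Function.update_apply]
      have : i = ⟨2 * n + 1, by omega⟩ ↔ (i : ℕ) = 2 * n + 1 := by
        rw [Fin.ext_iff]
      simp only [this, borderedIndex, idxC]
      split_ifs <;> first | rfl | omega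
    simp only [hidx]
    split_ifs <;> rfl
  · ext i j
    simp only [borderedIndex]
    split_ifs <;> rfl
end

section
/- Let m_{i,j} : ℝ² → ℝ and α_i : ℝ² → ℝ (i, j ∈ ℕ) be smooth functions of (t₁, t₂) satisfying m_{i,j} = −m_{j,i}, ∂_{t₁}m_{i,j} = m_{i+1,j} + m_{i,j+1}, ∂_{t₂}m_{i,j} = m_{i+2,j} + m_{i,j+2}, ∂_{t₁}α_i = α_{i+1}, and ∂_{t₂}α_i = α_{i+2} for all i, j. Define τ̂_0 = 1, τ̂_{2n} = Pf((m_{i,j})_{i,j=0}^{2n−1}), and τ̂_{2n+1} = Pf of (m_{i,j})_{i,j=0}^{2n} bordered by the row (α_0, …, α_{2n}). Then for every n ≥ 1: (D_{t₂} + D_{t₁}²) τ̂_n · τ̂_{n+1} = 2 τ̂_{n−1}·τ̂_{n+2}; explicitly, ∂_{t₂}τ̂_n·τ̂_{n+1} − τ̂_n·∂_{t₂}τ̂_{n+1} + ∂_{t₁}²τ̂_n·τ̂_{n+1} − 2∂_{t₁}τ̂_n·∂_{t₁}τ̂_{n+1} + τ̂_n·∂_{t₁}²τ̂_{n+1} =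 2 τ̂_{n−1}·τ̂_{n+2}. -/
/-- Partial derivative in the first variable `t₁`. -/
noncomputable def pd1 (f : ℝ × ℝ → ℝ) (p : ℝ × ℝ) : ℝ :=
  deriv (fun s => f (s, p.2)) p.1

/-- Partial derivative in the second variable `t₂`. -/
noncomputable def pd2 (f : ℝ × ℝ → ℝ) (p : ℝ × ℝ) : ℝ :=
  deriv (fun s => f (p.1, s)) p.2

/-- `τ̂_{2n}(t₁,t₂) = Pf((m_{i,j}(t₁,t₂))_{i,j=0}^{2n−1})`; in particular `τ̂_0 = 1`. -/
noncomputable def tauEvenT2 (m : ℕ → ℕ → ℝ × ℝ → ℝ) (n : ℕ) : ℝ × ℝ → ℝ :=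
  fun p => pfaffian (Matrix.of fun i j : Fin (2 * n) => m i j p)

/-- `τ̂_{2n+1}(t₁,t₂) = Pf` of `(m_{i,j})_{i,j=0}^{2n}` bordered by the α-row. -/
noncomputable def tauOddT2 (m : ℕ → ℕ → ℝ × ℝ → ℝ) (α : ℕ → ℝ × ℝ → ℝ) (n : ℕ) :
    ℝ × ℝ → ℝ :=
  fun p => pfaffian (Matrix.of fun i j : Fin (2 * (n + 1)) =>
    if (i : ℕ) = 0 then (if (j : ℕ) = 0 then 0 else α ((j : ℕ) - 1) p)
    else if (j : ℕ) = 0 then -α ((i : ℕ) - 1) p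
    else m ((i : ℕ) - 1) ((j : ℕ) - 1) p)

/-- The combined tau function sequence. -/
noncomputable def tauhatT2 (m : ℕ → ℕ → ℝ × ℝ → ℝ) (α : ℕ → ℝ × ℝ → ℝ) (n : ℕ) :
    ℝ × ℝ → ℝ :=
  if n % 2 = 0 then tauEvenT2 m (n / 2) else tauOddT2 m α (n / 2)

section Helpers

open ExteriorAlgebra CliffordAlgebra

section Perm

variable {ι R : Type*} [CommRing R]

/-- The signed sum of `g (w ∘ π)` over all permutations `π`. -/
def altSum {n : ℕ} (g : (Fin n → ι) → R) (w : Fin n → ι) : R :=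
  ∑ π : Equiv.Perm (Fin n), (Equiv.Perm.sign π : ℤ) • g (w ∘ π)

theorem altSum_comp_perm {n : ℕ} (g : (Fin n → ι) → R) (w : Fin n → ι)
    (σ : Equiv.Perm (Fin n)) :
    altSum g (w ∘ σ) = (Equiv.Perm.sign σ : ℤ) • altSum g w := by
  unfold altSum
  rw [Finset.smul_sum]
  refine Fintype.sum_equiv (Equiv.mulLeft σ) _ _ fun π => ?_
  have h : ((Equiv.Perm.sign σ : ℤˣ) : ℤ) * (Equiv.Perm.sign σ : ℤˣ) = 1 := by
    rw [← Units.val_mul, Int.units_mul_self, Units.val_one]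
  rw [Equiv.coe_mulLeft, Equiv.Perm.sign_mul, Units.val_mul, smul_smul, ← mul_assoc, h, one_mul]
  rfl

theorem altSum_succ {n : ℕ} (g : (Fin (n + 1) → ι) → R) (w : Fin (n + 1) → ι) :
    altSum g w = ∑ p : Fin (n + 1),
      (-1) ^ (p : ℕ) * altSum (fun u => g (Fin.cons (w p) u)) (w ∘ p.succAbove) := by
  have key : ∀ p : Fin (n + 1), ∑ e : Equiv.Perm (Fin n),
      (Equiv.Perm.sign (Equiv.Perm.decomposeFin.symm (p, e)) : ℤ) •
        g (w ∘ Equiv.Perm.decomposeFin.symm (p, e)) =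
      (-1) ^ (p : ℕ) * altSum (fun u => g (Fin.cons (w p) u)) (w ∘ p.succAbove) := by
    intro p
    have hw : ∀ e : Equiv.Perm (Fin n), w ∘ Equiv.Perm.decomposeFin.symm (p, e) =
        Fin.cons (w p) ((fun j : Fin n => w (Equiv.swap 0 p j.succ)) ∘ e) := by
      intro e
      ext j
      refine Fin.cases ?_ (fun j => ?_) j
      · simp
      · simp [Equiv.Perm.decomposeFin_symm_apply_succ]
    simp only [hw, Equiv.Perm.decomposeFin.symm_sign]
    refine Fin.cases ?_ (fun i => ?_) p
    · simp [altSum, Function.comp_def]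
    · have hs : (fun j : Fin n => w (Equiv.swap 0 i.succ j.succ)) =
          (w ∘ i.succ.succAbove) ∘ i.cycleRange := by
        ext j
        simp [Fin.succAbove_cycleRange]
      have := altSum_comp_perm (fun u => g (Fin.cons (w i.succ) u)) (w ∘ i.succ.succAbove)
        i.cycleRange
      rw [Fin.sign_cycleRange] at this
      have h2 : (-1 : R) ^ ((i.succ : Fin (n + 1)) : ℕ) *
          altSum (fun u => g (Fin.cons (w i.succ) u)) (w ∘ i.succ.succAbove) =
          - altSum (fun u => g (Fin.cons (w i.succ) u))
            ((w ∘ i.succ.succAbove) ∘ i.cycleRange) := by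
        rw [this, Fin.val_succ, pow_succ, zsmul_eq_mul]
        push_cast
        ring
      rw [h2, hs]
      simp [altSum, Fin.succ_ne_zero]
  rw [altSum, ← Equiv.sum_comp Equiv.Perm.decomposeFin.symm, Fintype.sum_prod_type]
  exact Finset.sum_congr rfl fun p _ => key p

end Perm

section Wick

variable {R V : Type*} [CommRing R] [AddCommGroup V] [Module R V]

theorem contractLeft_exteriorι_mul (f : Module.Dual R V) (v : V) (x : ExteriorAlgebra R V) :
    contractLeft f (ExteriorAlgebra.ι R v * x) =
      f v • x - ExteriorAlgebra.ι R v * contractLeft f x :=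
  contractLeft_ι_mul f v x

theorem contractLeft_exteriorι (f : Module.Dual R V) (v : V) :
    contractLeft f (ExteriorAlgebra.ι R v) = f v • (1 : ExteriorAlgebra R V) := by
  rw [← Algebra.algebraMap_eq_smul_one]
  exact contractLeft_ι (Q := 0) f v

theorem ι_mul_ιMulti_succAbove {n : ℕ} (w : Fin (n + 1) → V) (p : Fin (n + 1)) :
    ExteriorAlgebra.ι R (w p) * ιMulti R n (w ∘ p.succAbove) =
      (-1 : R) ^ (p : ℕ) • ιMulti R (n + 1) w := by
  have h : w ∘ p.cycleRange.symm = Fin.cons (w p) (w ∘ p.succAbove) := by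
    ext j
    refine Fin.cases ?_ (fun j => ?_) j <;> simp
  have h2 := (ιMulti R (n + 1)).map_perm w p.cycleRange.symm
  rw [h, ιMulti_succ_apply, Equiv.Perm.sign_symm, Fin.sign_cycleRange] at h2
  simp only [Fin.cons_zero] at h2
  have h3 : Matrix.vecTail (Fin.cons (w p) (w ∘ p.succAbove) : Fin (n + 1) → V) =
    w ∘ p.succAbove := by ext j; simp [Matrix.vecTail]
  rw [h3] at h2
  rw [h2, Units.smul_def, ← Int.cast_smul_eq_zsmul R]
  push_cast
  rfl

theorem contractLeft_ιMulti (f : Module.Dual R V) {n : ℕ} (w : Fin (n + 1) → V) :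
    contractLeft f (ιMulti R (n + 1) w) =
      ∑ j : Fin (n + 1), ((-1) ^ (j : ℕ) * f (w j)) • ιMulti R n (w ∘ j.succAbove) := by
  induction n with
  | zero =>
    rw [ιMulti_succ_apply, contractLeft_ι_mul]
    simp
  | succ n ih =>
    rw [ιMulti_succ_apply, contractLeft_ι_mul, ih, Fin.sum_univ_succ (n := n + 1), Finset.mul_sum,
      sub_eq_add_neg, ← Finset.sum_neg_distrib]
    congr 1
    · simp [Matrix.vecTail]
    · refine Finset.sum_congr rfl fun j _ => ?_
      have h : w ∘ j.succ.succAbove =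
          Fin.cons (w 0) (Matrix.vecTail w ∘ j.succAbove) := by
        ext k
        refine Fin.cases ?_ (fun k => ?_) k <;> simp [Matrix.vecTail]
      rw [ιMulti_succ_apply, h]
      have h3 : Matrix.vecTail (Fin.cons (w 0) (Matrix.vecTail w ∘ j.succAbove) : Fin (n + 1) → V) =
        Matrix.vecTail w ∘ j.succAbove := by ext j; simp [Matrix.vecTail]
      rw [h3, Fin.cons_zero, mul_smul_comm, ← neg_smul]
      congr 1
      simp [Matrix.vecTail, pow_succ]

/-- `φ` evaluates products of vectors by Wick's rule for the pairing `B`. -/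
structure IsWick (B : LinearMap.BilinForm R V) (φ : ExteriorAlgebra R V →ₗ[R] R) : Prop where
  map_one : φ 1 = 1
  map_ι_mul : ∀ v x, φ (ExteriorAlgebra.ι R v * x) = φ (contractLeft (B v) x)

theorem exists_isWick (B : LinearMap.BilinForm R V) (hB : ∀ v, B v v = 0) :
    ∃ φ : ExteriorAlgebra R V →ₗ[R] R, IsWick B φ := by
  have h : LinearMap.BilinMap.toQuadraticMap (-B) =
      (0 : QuadraticForm R V) - (0 : QuadraticForm R V) := by
    ext v
    simp [hB]
  refine ⟨(algebraMapInv (R := R) (M := V)).toLinearMap ∘ₗ changeForm h, ?_, ?_⟩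
  · simp [changeForm_one]
  · intro v x
    rw [LinearMap.comp_apply, LinearMap.comp_apply]
    erw [changeForm_ι_mul, changeForm_contractLeft]
    simp [algebraMapInv]

theorem IsWick.altSum_pair_mul {B : LinearMap.BilinForm R V} {φ : ExteriorAlgebra R V →ₗ[R] R}
    (hφ : IsWick B φ) {n : ℕ} (g : (Fin n → V) → R) (c : R)
    (hg : ∀ u, altSum g u = c * φ (ιMulti R n u)) (w : Fin (n + 2) → V) :
    altSum (fun u => B (u 0) (u 1) * g (fun k => u k.succ.succ)) w =
      (n + 2) * c * φ (ιMulti R (n + 2) w) := by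
  have hmul : ∀ (a : R) (u : Fin n → V), altSum (fun u => a * g u) u = a * altSum g u := by
    intro a u
    simp [altSum, Finset.mul_sum, mul_left_comm]
  have hterm : ∀ p : Fin (n + 2), (-1 : R) ^ (p : ℕ) * altSum (fun u : Fin (n + 1) → V =>
        B ((Fin.cons (w p) u : Fin (n + 2) → V) 0) ((Fin.cons (w p) u : Fin (n + 2) → V) 1) *
          g (fun k => (Fin.cons (w p) u : Fin (n + 2) → V) k.succ.succ)) (w ∘ p.succAbove) =
      c * φ (ιMulti R (n + 2) w) := by
    intro p
    have h1 := congrArg φ (ι_mul_ιMulti_succAbove (R := R) w p)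
    rw [hφ.map_ι_mul, contractLeft_ιMulti, map_smul, map_sum, smul_eq_mul] at h1
    have h4 : (-1 : R) ^ (p : ℕ) * (-1) ^ (p : ℕ) = 1 := by
      rw [← mul_pow]; simp
    rw [altSum_succ]
    simp only [← Fin.succ_zero_eq_one, Fin.cons_succ, Fin.cons_zero, hmul, hg]
    have h5 : c * φ (ιMulti R (n + 2) w) =
        (-1) ^ (p : ℕ) * (c * ((-1) ^ (p : ℕ) * φ (ιMulti R (n + 2) w))) := by
      linear_combination (-c * φ (ιMulti R (n + 2) w)) * h4
    rw [h5, ← h1, Finset.mul_sum, Finset.mul_sum, Finset.mul_sum]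
    refine Finset.sum_congr rfl fun q _ => ?_
    rw [map_smul, smul_eq_mul]
    simp only [Function.comp_apply]
    ring
  rw [altSum_succ, Fintype.sum_congr _ _ hterm, Finset.sum_const, Finset.card_univ,
    Fintype.card_fin, nsmul_eq_mul]
  push_cast
  ring

theorem IsWick.altSum_prod {B : LinearMap.BilinForm R V} {φ : ExteriorAlgebra R V →ₗ[R] R}
    (hφ : IsWick B φ) (N : ℕ) (w : Fin (2 * N) → V) :
    altSum (fun u : Fin (2 * N) → V => ∏ k : Fin N,
        B (u ⟨2 * (k : ℕ), by have := k.isLt; omega⟩)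
          (u ⟨2 * (k : ℕ) + 1, by have := k.isLt; omega⟩)) w =
      2 ^ N * N.factorial * φ (ιMulti R (2 * N) w) := by
  induction N with
  | zero =>
    have : ιMulti R (2 * 0) w = 1 := ιMulti_zero_apply w
    rw [this]
    simp [altSum, hφ.map_one]
  | succ N ih =>
    have h := hφ.altSum_pair_mul _ _ ih w
    simp only [Fin.prod_univ_succ]
    refine h.trans ?_
    rw [Nat.factorial_succ]
    push_cast
    ring_nf
    rfl

/-- The product in the exterior algebra of a list of vectors. -/
def wedge (l : List V) : ExteriorAlgebra R V := (l.map (ExteriorAlgebra.ι R)).prod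

/-- The sum of the products obtained from `wedge l` by applying `S` to one of the factors. -/
def wedgeDeriv (S : V → V) : List V → ExteriorAlgebra R V
  | [] => 0
  | v :: l => ExteriorAlgebra.ι R (S v) * wedge l + ExteriorAlgebra.ι R v * wedgeDeriv S l

@[simp] theorem wedge_nil : wedge (R := R) ([] : List V) = 1 := rfl

@[simp] theorem wedge_cons (v : V) (l : List V) :
    wedge (R := R) (v :: l) = ExteriorAlgebra.ι R v * wedge l := by simp [wedge]

@[simp] theorem wedge_append (k l : List V) :
    wedge (R := R) (k ++ l) = wedge k * wedge l := by simp [wedge]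

theorem wedgeDeriv_append (S : V → V) (k l : List V) :
    wedgeDeriv (R := R) S (k ++ l) = wedgeDeriv S k * wedge l + wedge k * wedgeDeriv S l := by
  induction k with
  | nil => simp [wedgeDeriv]
  | cons u k ih =>
    simp only [List.cons_append, wedgeDeriv, ih, wedge_append, wedge_cons]
    noncomm_ring

theorem wedgeDeriv_append_singleton (S : V → V) (l : List V) (v : V) :
    wedgeDeriv (R := R) S (l ++ [v]) =
      wedgeDeriv S l * ExteriorAlgebra.ι R v + wedge l * ExteriorAlgebra.ι R (S v) := by
  simp [wedgeDeriv_append, wedgeDeriv]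

theorem ι_mul_ι_swap (u v : V) : ExteriorAlgebra.ι R u * ExteriorAlgebra.ι R v =
    -(ExteriorAlgebra.ι R v * ExteriorAlgebra.ι R u) :=
  eq_neg_of_add_eq_zero_left (ι_add_mul_swap u v)

theorem ι_mul_wedge (v : V) (l : List V) : ExteriorAlgebra.ι R v * wedge l =
    (-1 : R) ^ l.length • (wedge l * ExteriorAlgebra.ι R v) := by
  induction l with
  | nil => simp
  | cons u l ih =>
    rw [wedge_cons, ← mul_assoc, ι_mul_ι_swap, neg_mul, mul_assoc, ih, List.length_cons, pow_succ,
      mul_smul_comm, mul_neg_one, neg_smul, mul_assoc]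

theorem ι_mul_wedge_of_mem {v : V} {l : List V} (h : v ∈ l) :
    ExteriorAlgebra.ι R v * wedge l = 0 := by
  induction l with
  | nil => simp at h
  | cons u l ih =>
    rw [wedge_cons, ← mul_assoc]
    rcases List.mem_cons.1 h with rfl | h
    · rw [ι_sq_zero, zero_mul]
    · rw [ι_mul_ι_swap, neg_mul, mul_assoc, ih h, mul_zero, neg_zero]

theorem contractLeft_wedge_mul {f : Module.Dual R V} {l : List V} (h : ∀ v ∈ l, f v = 0)
    (y : ExteriorAlgebra R V) : contractLeft f (wedge l * y) =
      (-1 : R) ^ l.length • (wedge l * contractLeft f y) := by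
  induction l with
  | nil => simp
  | cons u l ih =>
    rw [List.forall_mem_cons] at h
    rw [wedge_cons, mul_assoc, contractLeft_ι_mul, h.1, ih h.2, zero_smul, zero_sub,
      List.length_cons, pow_succ, mul_smul_comm, mul_neg_one, neg_smul, mul_assoc]

theorem IsWick.contractLeft_swap_aux {B : LinearMap.BilinForm R V}
    {φ : ExteriorAlgebra R V →ₗ[R] R} (hφ : IsWick B φ) (hB : ∀ u v, B u v = -B v u)
    (x y k : ExteriorAlgebra R V) :
    φ (contractLeft (φ ∘ₗ LinearMap.mulLeft R k ∘ₗ contractLeft.flip x ∘ₗ B) y) =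
      -φ (k * contractLeft (φ ∘ₗ LinearMap.mulRight R y ∘ₗ ExteriorAlgebra.ι R) x) := by
  induction x using CliffordAlgebra.left_induction generalizing k with
  | algebraMap r =>
    have : φ ∘ₗ LinearMap.mulLeft R k ∘ₗ contractLeft.flip
        (algebraMap R (ExteriorAlgebra R V) r) ∘ₗ B = 0 := by
      ext v
      simp [contractLeft_algebraMap]
    rw [this, contractLeft_algebraMap]
    simp
  | add x₁ x₂ h₁ h₂ =>
    have : φ ∘ₗ LinearMap.mulLeft R k ∘ₗ contractLeft.flip (x₁ + x₂) ∘ₗ B =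
        φ ∘ₗ LinearMap.mulLeft R k ∘ₗ contractLeft.flip x₁ ∘ₗ B +
        φ ∘ₗ LinearMap.mulLeft R k ∘ₗ contractLeft.flip x₂ ∘ₗ B := by
      ext v
      simp [mul_add]
    rw [this, map_add, LinearMap.add_apply, map_add, h₁, h₂, map_add, mul_add, map_add]
    ring
  | ι_mul x u ih =>
    have : φ ∘ₗ LinearMap.mulLeft R k ∘ₗ contractLeft.flip (ExteriorAlgebra.ι R u * x) ∘ₗ B =
        -(φ (k * x) • B u) - φ ∘ₗ LinearMap.mulLeft R (k * ExteriorAlgebra.ι R u) ∘ₗ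
          contractLeft.flip x ∘ₗ B := by
      ext v
      simp [contractLeft_exteriorι_mul, mul_sub, hB v u, mul_comm]
    erw [this, contractLeft_exteriorι_mul]
    rw [map_sub, LinearMap.sub_apply, map_sub, ih, map_neg, map_smul, LinearMap.neg_apply,
      LinearMap.smul_apply, map_neg, map_smul, ← hφ.map_ι_mul]
    simp [mul_sub, mul_assoc, mul_comm]
    ring

theorem IsWick.contractLeft_swap {B : LinearMap.BilinForm R V}
    {φ : ExteriorAlgebra R V →ₗ[R] R} (hφ : IsWick B φ) (hB : ∀ u v, B u v = -B v u)
    (x y : ExteriorAlgebra R V) :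
    φ (contractLeft (φ ∘ₗ LinearMap.mulRight R x ∘ₗ ExteriorAlgebra.ι R) y) =
      -φ (contractLeft (φ ∘ₗ LinearMap.mulRight R y ∘ₗ ExteriorAlgebra.ι R) x) := by
  have h := hφ.contractLeft_swap_aux hB x y 1
  have h2 : φ ∘ₗ LinearMap.mulLeft R 1 ∘ₗ contractLeft.flip x ∘ₗ B =
      φ ∘ₗ LinearMap.mulRight R x ∘ₗ ExteriorAlgebra.ι R := by
    ext v
    simp [hφ.map_ι_mul]
  rwa [h2, one_mul] at h

theorem IsWick.plucker_even {B : LinearMap.BilinForm R V}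
    {φ : ExteriorAlgebra R V →ₗ[R] R} (hφ : IsWick B φ) (hB : ∀ u v, B u v = -B v u)
    {l : List V} (hl : Even l.length) (a b c d : V) :
    φ (wedge ([a] ++ (l ++ [d]))) * φ (wedge (l ++ [b, c])) -
      φ (wedge ([a] ++ (l ++ [c]))) * φ (wedge (l ++ [b, d])) +
      φ (wedge ([a] ++ (l ++ [b]))) * φ (wedge (l ++ [c, d])) =
    φ (wedge l) * φ (wedge ([a] ++ (l ++ [b, c, d]))) := by
  have h := hφ.contractLeft_swap hB (wedge (a :: l)) (wedge (l ++ [b, c, d]))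
  rw [wedge_append, contractLeft_wedge_mul (l := l), wedge_cons, contractLeft_ι_mul,
    ← mul_one (wedge l), contractLeft_wedge_mul (l := l), hl.neg_one_pow] at h
  · simp [contractLeft_exteriorι_mul, contractLeft_exteriorι, mul_sub, mul_assoc,
      -contractLeft_ι] at h
    have hv : ∀ v, φ (ExteriorAlgebra.ι R v * (ExteriorAlgebra.ι R a * wedge l)) =
        - φ (ExteriorAlgebra.ι R a * (wedge l * ExteriorAlgebra.ι R v)) := by
      intro v
      rw [← mul_assoc, ι_mul_ι_swap, neg_mul, mul_assoc, ι_mul_wedge, hl.neg_one_pow, one_smul,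
        map_neg]
    simp only [hv] at h
    simp only [List.cons_append, List.nil_append, wedge_cons, wedge_append,
      wedge_nil, mul_one]
    linear_combination -h
  · intro v hv
    simp [← mul_assoc, ι_mul_wedge_of_mem hv]
  · intro v hv
    simp only [LinearMap.comp_apply, LinearMap.mulRight_apply, wedge_cons]
    rw [← mul_assoc, ι_mul_ι_swap, neg_mul, mul_assoc, ι_mul_wedge_of_mem hv]
    simp

theorem IsWick.plucker_odd {B : LinearMap.BilinForm R V}
    {φ : ExteriorAlgebra R V →ₗ[R] R} (hφ : IsWick B φ) (hB : ∀ u v, B u v = -B v u)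
    {l : List V} (hl : Odd l.length) (a b c d : V) :
    φ (wedge (l ++ [d])) * φ (wedge ([a] ++ (l ++ [b, c]))) -
      φ (wedge (l ++ [c])) * φ (wedge ([a] ++ (l ++ [b, d]))) +
      φ (wedge (l ++ [b])) * φ (wedge ([a] ++ (l ++ [c, d]))) =
    φ (wedge ([a] ++ l)) * φ (wedge (l ++ [b, c, d])) := by
  have h := hφ.contractLeft_swap hB (wedge l) (wedge (l ++ [a, b, c, d]))
  rw [wedge_append, contractLeft_wedge_mul (l := l), ← mul_one (wedge l),
    contractLeft_wedge_mul (l := l), hl.neg_one_pow] at h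
  · simp [contractLeft_exteriorι_mul, contractLeft_exteriorι, mul_sub, -contractLeft_ι] at h
    have hv : ∀ v, φ (ExteriorAlgebra.ι R v * wedge l) =
        - φ (wedge l * ExteriorAlgebra.ι R v) := by
      intro v
      rw [ι_mul_wedge, hl.neg_one_pow, neg_smul, one_smul, map_neg]
    have ha : ∀ z, ExteriorAlgebra.ι R a * (wedge l * z) =
        -(wedge l * (ExteriorAlgebra.ι R a * z)) := by
      intro z
      rw [← mul_assoc, ι_mul_wedge, hl.neg_one_pow, neg_smul, one_smul, neg_mul, mul_assoc]
    simp [hv] at h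
    simp [ha, hv]
    linear_combination h
  · intro v hv
    simp [← mul_assoc, ι_mul_wedge_of_mem hv]
  · intro v hv
    simp [ι_mul_wedge_of_mem hv]

end Wick

section Deriv

variable {V : Type*} [AddCommGroup V] [Module ℝ V]

theorem IsWick.hasDerivAt_wedge {B : ℝ → LinearMap.BilinForm ℝ V}
    {φ : ℝ → ExteriorAlgebra ℝ V →ₗ[ℝ] ℝ} (hφ : ∀ s, IsWick (B s) (φ s)) (S : V → V) (s₀ : ℝ)
    (hB : ∀ u v, HasDerivAt (fun s => B s u v) (B s₀ (S u) v + B s₀ u (S v)) s₀) (l : List V) :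
    HasDerivAt (fun s => φ s (wedge l)) (φ s₀ (wedgeDeriv S l)) s₀ := by
  obtain ⟨N, hN⟩ : ∃ N, l.length ≤ N := ⟨_, le_rfl⟩
  induction N generalizing l with
  | zero =>
    obtain rfl : l = [] := List.length_eq_zero_iff.1 (by omega)
    simp only [wedge_nil, (hφ _).map_one, wedgeDeriv, map_zero]
    exact hasDerivAt_const _ _
  | succ N ih =>
    have inner : ∀ (l k : List V) (v : V), k.length + l.length ≤ N + 1 →
        HasDerivAt (fun s => φ s (wedge k * contractLeft (B s v) (wedge l)))
          (φ s₀ (wedgeDeriv S k * contractLeft (B s₀ v) (wedge l)) +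
            φ s₀ (wedge k * contractLeft (B s₀ (S v)) (wedge l)) +
            φ s₀ (wedge k * contractLeft (B s₀ v) (wedgeDeriv S l))) s₀ := by
      intro l
      induction l with
      | nil =>
        intro k v _
        have h0 : ∀ f : Module.Dual ℝ V, contractLeft f (1 : ExteriorAlgebra ℝ V) = 0 :=
          contractLeft_one (Q := 0)
        simp only [wedge_nil, h0, wedgeDeriv, map_zero, mul_zero, add_zero]
        exact hasDerivAt_const _ _
      | cons u l ihl =>
        intro k v hk
        rw [List.length_cons] at hk
        have h1 := ih (k ++ l) (by rw [List.length_append]; omega)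
        have h2 := ihl (k ++ [u]) v (by rw [List.length_append, List.length_singleton]; omega)
        have hf : (fun s => φ s (wedge k * contractLeft (B s v) (wedge (u :: l)))) = fun s =>
            B s v u * φ s (wedge (k ++ l)) -
              φ s (wedge (k ++ [u]) * contractLeft (B s v) (wedge l)) := by
          ext s
          simp [contractLeft_exteriorι_mul, mul_sub, mul_assoc]
        rw [hf]
        refine (((hB v u).mul h1).sub h2).congr_deriv ?_
        simp only [wedgeDeriv, wedgeDeriv_append, wedge_append, wedge_cons, wedge_nil,
          contractLeft_exteriorι_mul, map_add, map_sub, mul_add, mul_sub, add_mul,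
          mul_assoc, mul_one, mul_zero, add_zero, map_smul, mul_smul_comm, smul_eq_mul]
        ring
    match l, hN with
    | [], _ =>
      simp only [wedge_nil, (hφ _).map_one, wedgeDeriv, map_zero]
      exact hasDerivAt_const _ _
    | v :: l, hN =>
      have h := inner l [] v (by simp at hN ⊢; omega)
      simpa [(hφ _).map_ι_mul, wedgeDeriv] using h

end Deriv

section Moments

variable {R I : Type*} [CommRing R]

/-- The bilinear form on `I →₀ R` with Gram matrix `M`. -/
noncomputable def gramForm (M : I → I → R) : LinearMap.BilinForm R (I →₀ R) :=
  Finsupp.linearCombination R fun i => Finsupp.linearCombination R (M i)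

@[simp] theorem gramForm_single (M : I → I → R) (i j : I) (a b : R) :
    gramForm M (Finsupp.single i a) (Finsupp.single j b) = a * (b * M i j) := by
  simp [gramForm]

theorem gramForm_skew {M : I → I → R} (hM : ∀ i j, M i j = -M j i) (u v : I →₀ R) :
    gramForm M u v = -gramForm M v u := by
  induction u using Finsupp.induction_linear with
  | zero => simp
  | add u₁ u₂ h₁ h₂ => simp [h₁, h₂, add_comm]
  | single i a =>
    induction v using Finsupp.induction_linear with
    | zero => simp
    | add v₁ v₂ h₁ h₂ => simp [h₁, h₂, add_comm]
    | single j b =>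
      rw [gramForm_single, gramForm_single, hM i j]
      ring

theorem hasDerivAt_gramForm {M : ℝ → I → I → ℝ} {S : (I →₀ ℝ) →ₗ[ℝ] (I →₀ ℝ)} {s₀ : ℝ}
    (h : ∀ i j, HasDerivAt (fun s => M s i j)
      (gramForm (M s₀) (S (Finsupp.single i 1)) (Finsupp.single j 1) +
        gramForm (M s₀) (Finsupp.single i 1) (S (Finsupp.single j 1))) s₀) (u v : I →₀ ℝ) :
    HasDerivAt (fun s => gramForm (M s) u v)
      (gramForm (M s₀) (S u) v + gramForm (M s₀) u (S v)) s₀ := by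
  induction u using Finsupp.induction_linear with
  | zero => simpa using hasDerivAt_const s₀ (0 : ℝ)
  | add u₁ u₂ h₁ h₂ =>
    simp only [map_add, LinearMap.add_apply]
    exact (h₁.add h₂).congr_deriv (by ring)
  | single i a =>
    induction v using Finsupp.induction_linear with
    | zero => simpa using hasDerivAt_const s₀ (0 : ℝ)
    | add v₁ v₂ h₁ h₂ =>
      simp only [map_add]
      exact (h₁.add h₂).congr_deriv (by ring)
    | single j b =>
      simp only [gramForm_single]
      refine (((h i j).const_mul b).const_mul a).congr_deriv ?_
      have hs (i : I) (a : ℝ) : Finsupp.single i a = a • Finsupp.single i 1 := by simp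
      rw [hs i a, hs j b]
      simp only [map_smul, LinearMap.smul_apply, smul_eq_mul]
      ring

theorem IsWick.pfaffian_eq {V : Type*} [AddCommGroup V] [Module ℝ V]
    {B : LinearMap.BilinForm ℝ V} {φ : ExteriorAlgebra ℝ V →ₗ[ℝ] ℝ} (hφ : IsWick B φ) {N : ℕ}
    (w : Fin (2 * N) → V) :
    pfaffian (Matrix.of fun i j => B (w i) (w j)) = φ (wedge (List.ofFn w)) := by
  have h := hφ.altSum_prod N w
  have hw : ιMulti ℝ (2 * N) w = wedge (List.ofFn w) := by
    rw [ιMulti_apply, wedge, List.map_ofFn]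
    rfl
  rw [hw] at h
  have h2 : (2 ^ N * N.factorial : ℝ) ≠ 0 := by positivity
  rw [pfaffian, show (∑ π : Equiv.Perm (Fin (2 * N)), (Equiv.Perm.sign π : ℤ) •
      ∏ k : Fin N, Matrix.of (fun i j => B (w i) (w j))
        (π ⟨2 * (k : ℕ), by have := k.isLt; omega⟩)
        (π ⟨2 * (k : ℕ) + 1, by have := k.isLt; omega⟩)) = _ from h]
  simp only [one_div, map_inv₀, map_mul, map_pow, map_natCast, map_ofNat]
  exact inv_mul_cancel_left₀ h2 _

/-- The list `l, e 0, …, e (k - 1)`. -/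
def word {V : Type*} (e : ℕ → V) (l : List V) (k : ℕ) : List V := l ++ (List.range k).map e

theorem word_succ {V : Type*} (e : ℕ → V) (l : List V) (k : ℕ) :
    word e l (k + 1) = word e l k ++ [e k] := by
  simp [word, List.range_succ]

end Moments

section Word

variable {R V : Type*} [CommRing R] [AddCommGroup V] [Module R V] {e : ℕ → V} {l : List V}

theorem wedgeDeriv_word_one {S : V → V} (hS : ∀ i, S (e i) = e (i + 1))
    (hl : wedgeDeriv (R := R) S l = 0) (k : ℕ) :
    wedgeDeriv (R := R) S (word e l (k + 1)) = wedge (word e l k ++ [e (k + 1)]) := by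
  induction k with
  | zero =>
    rw [word_succ, wedgeDeriv_append_singleton, hS]
    simp [word, hl]
  | succ k ih =>
    rw [word_succ, wedgeDeriv_append_singleton, ih, hS]
    simp [mul_assoc]

theorem wedgeDeriv_word_two_mul {S T : V → V} (hS : ∀ i, S (e i) = e (i + 1))
    (hT : ∀ i, T (e i) = e (i + 2)) (hSl : wedgeDeriv (R := R) S l = 0)
    (hTl : wedgeDeriv (R := R) T l = 0) (k : ℕ) :
    wedgeDeriv (R := R) T (word e l k) * ExteriorAlgebra.ι R (e k) =
      -(wedgeDeriv S (word e l k) * ExteriorAlgebra.ι R (e (k + 1))) := by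
  induction k with
  | zero => simp [word, hSl, hTl]
  | succ k ih =>
    rw [wedgeDeriv_word_one hS hSl, word_succ, wedgeDeriv_append_singleton, hT, ih,
      wedge_append, wedge_cons, wedge_nil, add_mul, neg_mul, mul_assoc, mul_assoc,
      ι_mul_ι_swap (e (k + 2))]
    simp [mul_assoc]

end Word

theorem length_word {V : Type*} (e : ℕ → V) (l : List V) (k : ℕ) :
    (word e l k).length = l.length + k := by
  simp [word]

section Hirota

variable {V : Type*} [AddCommGroup V] [Module ℝ V] {B : ℝ × ℝ → LinearMap.BilinForm ℝ V}
  {φ : ℝ × ℝ → ExteriorAlgebra ℝ V →ₗ[ℝ] ℝ} {S T : V → V} {e : ℕ → V}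

theorem pd1_wedge (hφ : ∀ p, IsWick (B p) (φ p))
    (hS : ∀ p u v, HasDerivAt (fun s => B (s, p.2) u v) (B p (S u) v + B p u (S v)) p.1)
    (l : List V) : pd1 (fun p => φ p (wedge l)) = fun p => φ p (wedgeDeriv S l) := by
  ext p
  exact (IsWick.hasDerivAt_wedge (B := fun s => B (s, p.2)) (φ := fun s => φ (s, p.2))
    (fun s => hφ _) S p.1 (hS p) l).deriv

theorem pd2_wedge (hφ : ∀ p, IsWick (B p) (φ p))
    (hT : ∀ p u v, HasDerivAt (fun s => B (p.1, s) u v) (B p (T u) v + B p u (T v)) p.2)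
    (l : List V) : pd2 (fun p => φ p (wedge l)) = fun p => φ p (wedgeDeriv T l) := by
  ext p
  exact (IsWick.hasDerivAt_wedge (B := fun s => B (p.1, s)) (φ := fun s => φ (p.1, s))
    (fun s => hφ _) T p.2 (hT p) l).deriv

/-- The Hirota bilinear expression `(D_{t₂} + D_{t₁}²) f · g`. -/
noncomputable def hirota (f g : ℝ × ℝ → ℝ) (p : ℝ × ℝ) : ℝ :=
  pd2 f p * g p - f p * pd2 g p + pd1 (pd1 f) p * g p - 2 * pd1 f p * pd1 g p +
    f p * pd1 (pd1 g) p

theorem hirota_word (hφ : ∀ p, IsWick (B p) (φ p))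
    (hS : ∀ p u v, HasDerivAt (fun s => B (s, p.2) u v) (B p (S u) v + B p u (S v)) p.1)
    (hT : ∀ p u v, HasDerivAt (fun s => B (p.1, s) u v) (B p (T u) v + B p u (T v)) p.2)
    (hSe : ∀ i, S (e i) = e (i + 1)) (hTe : ∀ i, T (e i) = e (i + 2)) {l l' : List V}
    (hSl : wedgeDeriv (R := ℝ) S l = 0) (hTl : wedgeDeriv (R := ℝ) T l = 0)
    (hSl' : wedgeDeriv (R := ℝ) S l' = 0) (hTl' : wedgeDeriv (R := ℝ) T l' = 0)
    (k : ℕ) (p : ℝ × ℝ) :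
    hirota (fun p => φ p (wedge (word e l (k + 1)))) (fun p => φ p (wedge (word e l' (k + 2)))) p =
      2 * (φ p (wedge (word e l k ++ [e (k + 2)])) *
          φ p (wedge (word e l' k ++ [e k, e (k + 1)])) -
        φ p (wedge (word e l k ++ [e (k + 1)])) *
          φ p (wedge (word e l' k ++ [e k, e (k + 2)])) +
        φ p (wedge (word e l k ++ [e k])) *
          φ p (wedge (word e l' k ++ [e (k + 1), e (k + 2)]))) := by
  have first (l : List V) (hSl : wedgeDeriv (R := ℝ) S l = 0) (k : ℕ) :
      pd1 (fun p => φ p (wedge (word e l (k + 1)))) =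
        fun p => φ p (wedge (word e l k ++ [e (k + 1)])) := by
    rw [pd1_wedge hφ hS, wedgeDeriv_word_one hSe hSl]
  have second (l : List V) (hSl : wedgeDeriv (R := ℝ) S l = 0) (k : ℕ) :
      pd1 (pd1 (fun p => φ p (wedge (word e l (k + 1))))) p =
        φ p (wedgeDeriv S (word e l k) * ExteriorAlgebra.ι ℝ (e (k + 1))) +
          φ p (wedge (word e l k ++ [e (k + 2)])) := by
    rw [first l hSl, pd1_wedge hφ hS, wedgeDeriv_append_singleton, hSe]
    simp
  have time (l : List V) (hSl : wedgeDeriv (R := ℝ) S l = 0)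
      (hTl : wedgeDeriv (R := ℝ) T l = 0) (k : ℕ) :
      pd2 (fun p => φ p (wedge (word e l (k + 1)))) p =
        -φ p (wedgeDeriv S (word e l k) * ExteriorAlgebra.ι ℝ (e (k + 1))) +
          φ p (wedge (word e l k ++ [e (k + 2)])) := by
    rw [pd2_wedge hφ hT, word_succ, wedgeDeriv_append_singleton, hTe,
      wedgeDeriv_word_two_mul hSe hTe hSl hTl]
    simp
  rw [hirota, second l hSl, second l' hSl', time l hSl hTl, time l' hSl' hTl', first l hSl,
    first l' hSl', wedgeDeriv_word_one hSe hSl']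
  simp only [word_succ, wedge_append, wedge_cons, wedge_nil, mul_one, mul_assoc]
  ring

theorem hirota_word_nil_singleton (hφ : ∀ p, IsWick (B p) (φ p))
    (hB : ∀ p u v, B p u v = -B p v u)
    (hS : ∀ p u v, HasDerivAt (fun s => B (s, p.2) u v) (B p (S u) v + B p u (S v)) p.1)
    (hT : ∀ p u v, HasDerivAt (fun s => B (p.1, s) u v) (B p (T u) v + B p u (T v)) p.2)
    (hSe : ∀ i, S (e i) = e (i + 1)) (hTe : ∀ i, T (e i) = e (i + 2)) {a : V}
    (hSa : S a = 0) (hTa : T a = 0) {F : ℕ → ℝ × ℝ → ℝ}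
    (hF₀ : ∀ n, F (2 * n) = fun p => φ p (wedge (word e [] (2 * n))))
    (hF₁ : ∀ n, F (2 * n + 1) = fun p => φ p (wedge (word e [a] (2 * n + 1))))
    (k : ℕ) (p : ℝ × ℝ) :
    hirota (F (k + 1)) (F (k + 2)) p = 2 * F k p * F (k + 3) p := by
  have hS₀ : wedgeDeriv (R := ℝ) S ([] : List V) = 0 := rfl
  have hT₀ : wedgeDeriv (R := ℝ) T ([] : List V) = 0 := rfl
  have hS₁ : wedgeDeriv (R := ℝ) S [a] = 0 := by simp [wedgeDeriv, hSa]
  have hT₁ : wedgeDeriv (R := ℝ) T [a] = 0 := by simp [wedgeDeriv, hTa]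
  have ha (j : ℕ) : word e [a] j = [a] ++ word e [] j := rfl
  rcases Nat.even_or_odd' k with ⟨n, rfl | rfl⟩
  · have h := (hφ p).plucker_even (hB p) (l := word e [] (2 * n)) (by simp [length_word])
      a (e (2 * n)) (e (2 * n + 1)) (e (2 * n + 2))
    rw [hF₀, hF₁, show 2 * n + 2 = 2 * (n + 1) by ring, hF₀,
      show 2 * n + 3 = 2 * (n + 1) + 1 by ring, hF₁, show 2 * (n + 1) = 2 * n + 2 by ring,
      hirota_word hφ hS hT hSe hTe hS₁ hT₁ hS₀ hT₀]
    simp only [word_succ, ha, List.append_assoc, List.cons_append, List.nil_append] at h ⊢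
    rw [h]
    ring
  · have h := (hφ p).plucker_odd (hB p) (l := word e [] (2 * n + 1)) (by simp [length_word])
      a (e (2 * n + 1)) (e (2 * n + 2)) (e (2 * n + 3))
    rw [hF₁, show 2 * n + 1 + 1 = 2 * (n + 1) by ring, hF₀,
      show 2 * n + 1 + 2 = 2 * (n + 1) + 1 by ring, hF₁,
      show 2 * n + 1 + 3 = 2 * (n + 2) by ring, hF₀, show 2 * (n + 1) = 2 * n + 1 + 1 by ring,
      show 2 * (n + 2) = 2 * n + 1 + 3 by ring,
      hirota_word hφ hS hT hSe hTe hS₀ hT₀ hS₁ hT₁]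
    simp only [word_succ, ha, List.append_assoc, List.cons_append, List.nil_append] at h ⊢
    rw [h]
    ring

end Hirota

section BorderedArray

/-- The skew-symmetric array `m` bordered by the row `α`, indexed by `none`. -/
def borderedArray (m : ℕ → ℕ → ℝ) (α : ℕ → ℝ) : Option ℕ → Option ℕ → ℝ
  | none, none => 0
  | none, some j => α j
  | some i, none => -α i
  | some i, some j => m i j

/-- The linear map sending `some i` to `some (i + c)` and `none` to `0`. -/
noncomputable def shift (c : ℕ) : (Option ℕ →₀ ℝ) →ₗ[ℝ] (Option ℕ →₀ ℝ) :=
  Finsupp.linearCombination ℝ fun o => o.elim 0 fun i => Finsupp.single (some (i + c)) 1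

@[simp] theorem shift_some (c i : ℕ) :
    shift c (Finsupp.single (some i) 1) = Finsupp.single (some (i + c)) 1 := by
  simp [shift]

@[simp] theorem shift_none (c : ℕ) : shift c (Finsupp.single none 1) = 0 := by
  simp [shift]

theorem borderedArray_skew {m : ℕ → ℕ → ℝ} (α : ℕ → ℝ) (hm : ∀ i j, m i j = -m j i) :
    ∀ i j, borderedArray m α i j = -borderedArray m α j i
  | none, none => by simp [borderedArray]
  | none, some j => by simp [borderedArray]
  | some i, none => by simp [borderedArray]
  | some i, some j => hm i j

theorem hasDerivAt_gramForm_borderedArray {m : ℝ → ℕ → ℕ → ℝ} {α : ℝ → ℕ → ℝ} {c : ℕ} {s₀ : ℝ}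
    (hm : ∀ i j, HasDerivAt (fun s => m s i j) (m s₀ (i + c) j + m s₀ i (j + c)) s₀)
    (hα : ∀ i, HasDerivAt (fun s => α s i) (α s₀ (i + c)) s₀) (u v : Option ℕ →₀ ℝ) :
    HasDerivAt (fun s => gramForm (borderedArray (m s) (α s)) u v)
      (gramForm (borderedArray (m s₀) (α s₀)) (shift c u) v +
        gramForm (borderedArray (m s₀) (α s₀)) u (shift c v)) s₀ := by
  refine hasDerivAt_gramForm (M := fun s => borderedArray (m s) (α s)) ?_ u v
  rintro (_ | i) (_ | j)
  · simpa [borderedArray] using hasDerivAt_const s₀ (0 : ℝ)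
  · simpa [borderedArray] using hα j
  · simpa [borderedArray] using (hα i).fun_neg
  · simpa [borderedArray] using hm i j

theorem IsWick.tauEvenT2_eq {m : ℕ → ℕ → ℝ × ℝ → ℝ} {α : ℕ → ℝ × ℝ → ℝ}
    {φ : ℝ × ℝ → ExteriorAlgebra ℝ (Option ℕ →₀ ℝ) →ₗ[ℝ] ℝ}
    (hφ : ∀ p, IsWick (gramForm (borderedArray (fun i j => m i j p) fun i => α i p)) (φ p))
    (n : ℕ) : tauEvenT2 m n =
      fun p => φ p (wedge (word (fun i => Finsupp.single (some i) 1) [] (2 * n))) := by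
  ext p
  have h := (hφ p).pfaffian_eq (N := n) fun i => Finsupp.single (some (i : ℕ)) 1
  have hl : List.ofFn (fun i : Fin (2 * n) => (Finsupp.single (some (i : ℕ)) 1 : Option ℕ →₀ ℝ)) =
      word (fun i => Finsupp.single (some i) 1) [] (2 * n) := by
    apply List.ext_getElem <;> simp [word]
  rw [hl] at h
  rw [← h, tauEvenT2]
  congr 1
  ext i j
  simp [borderedArray]

theorem IsWick.tauOddT2_eq {m : ℕ → ℕ → ℝ × ℝ → ℝ} {α : ℕ → ℝ × ℝ → ℝ}
    {φ : ℝ × ℝ → ExteriorAlgebra ℝ (Option ℕ →₀ ℝ) →ₗ[ℝ] ℝ}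
    (hφ : ∀ p, IsWick (gramForm (borderedArray (fun i j => m i j p) fun i => α i p)) (φ p))
    (n : ℕ) : tauOddT2 m α n = fun p => φ p (wedge
      (word (fun i => Finsupp.single (some i) 1) [Finsupp.single none 1] (2 * n + 1))) := by
  ext p
  have h := (hφ p).pfaffian_eq (N := n + 1) fun i =>
    Finsupp.single (if (i : ℕ) = 0 then none else some ((i : ℕ) - 1)) 1
  have hl : List.ofFn (fun i : Fin (2 * (n + 1)) =>
      (Finsupp.single (if (i : ℕ) = 0 then none else some ((i : ℕ) - 1)) 1 : Option ℕ →₀ ℝ)) =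
      word (fun i => Finsupp.single (some i) 1) [Finsupp.single none 1] (2 * n + 1) := by
    apply List.ext_getElem
    · simp [word, mul_add]
    · intro i h₁ h₂
      rw [List.getElem_ofFn]
      cases i <;> simp [word]
  rw [hl] at h
  rw [← h, tauOddT2]
  congr 1
  ext ⟨_ | i, hi⟩ ⟨_ | j, hj⟩ <;> simp [borderedArray]

theorem hasDerivAt_pd1 {f : ℝ × ℝ → ℝ} (hf : Differentiable ℝ f) (p : ℝ × ℝ) :
    HasDerivAt (fun s => f (s, p.2)) (pd1 f p) p.1 :=
  (hf.comp (differentiable_id.prodMk (differentiable_const p.2))).differentiableAt.hasDerivAt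

theorem hasDerivAt_pd2 {f : ℝ × ℝ → ℝ} (hf : Differentiable ℝ f) (p : ℝ × ℝ) :
    HasDerivAt (fun s => f (p.1, s)) (pd2 f p) p.2 :=
  (hf.comp ((differentiable_const p.1).prodMk differentiable_id)).differentiableAt.hasDerivAt

end BorderedArray

end Helpers

/-- first member of the large BKP hierarchy: for skew-symmetric moments with
`∂_{t₁}m_{i,j} = m_{i+1,j} + m_{i,j+1}`, `∂_{t₂}m_{i,j} = m_{i+2,j} + m_{i,j+2}`,
`∂_{t₁}α_i = α_{i+1}`, `∂_{t₂}α_i = α_{i+2}`, the tau functions satisfy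
`(D_{t₂} + D_{t₁}²) τ̂ₙ · τ̂_{n+1} = 2 τ̂_{n−1}·τ̂_{n+2}` for all `n ≥ 1`. -/
theorem stmt15 (m : ℕ → ℕ → ℝ × ℝ → ℝ) (α : ℕ → ℝ × ℝ → ℝ)
    (hskew : ∀ i j p, m i j p = -m j i p)
    (hmsmooth : ∀ i j, ContDiff ℝ (⊤ : ℕ∞) (m i j))
    (hαsmooth : ∀ i, ContDiff ℝ (⊤ : ℕ∞) (α i))
    (hm1 : ∀ i j p, pd1 (m i j) p = m (i + 1) j p + m i (j + 1) p)
    (hm2 : ∀ i j p, pd2 (m i j) p = m (i + 2) j p + m i (j + 2) p)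
    (hα1 : ∀ i p, pd1 (α i) p = α (i + 1) p)
    (hα2 : ∀ i p, pd2 (α i) p = α (i + 2) p) :
    ∀ n : ℕ, 1 ≤ n → ∀ p : ℝ × ℝ,
      pd2 (tauhatT2 m α n) p * tauhatT2 m α (n + 1) p -
          tauhatT2 m α n p * pd2 (tauhatT2 m α (n + 1)) p +
        pd1 (pd1 (tauhatT2 m α n)) p * tauhatT2 m α (n + 1) p -
          2 * pd1 (tauhatT2 m α n) p * pd1 (tauhatT2 m α (n + 1)) p +
        tauhatT2 m α n p * pd1 (pd1 (tauhatT2 m α (n + 1))) p =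
      2 * tauhatT2 m α (n - 1) p * tauhatT2 m α (n + 2) p := by
  rintro (_ | k) hn p
  · omega
  have hB (p : ℝ × ℝ) := gramForm_skew
    (borderedArray_skew (fun i => α i p) (m := fun i j => m i j p) fun i j => hskew i j p)
  choose φ hφ using fun p => exists_isWick _ fun v => self_eq_neg.1 (hB p v v)
  have hmd i j : Differentiable ℝ (m i j) := (hmsmooth i j).differentiable (by simp)
  have hαd i : Differentiable ℝ (α i) := (hαsmooth i).differentiable (by simp)
  refine hirota_word_nil_singleton (S := shift 1) (T := shift 2) (F := tauhatT2 m α)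
    (e := fun i => Finsupp.single (some i) 1) (a := Finsupp.single none 1) hφ hB
    (fun p => hasDerivAt_gramForm_borderedArray (m := fun s i j => m i j (s, p.2))
      (α := fun s i => α i (s, p.2)) (fun i j => ?_) fun i => ?_)
    (fun p => hasDerivAt_gramForm_borderedArray (m := fun s i j => m i j (p.1, s))
      (α := fun s i => α i (p.1, s)) (fun i j => ?_) fun i => ?_)
    (shift_some 1) (shift_some 2) (shift_none 1) (shift_none 2) (fun n => ?_) (fun n => ?_) k p
  · exact hm1 i j p ▸ hasDerivAt_pd1 (hmd i j) p
  · exact hα1 i p ▸ hasDerivAt_pd1 (hαd i) p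
  · exact hm2 i j p ▸ hasDerivAt_pd2 (hmd i j) p
  · exact hα2 i p ▸ hasDerivAt_pd2 (hαd i) p
  · rw [tauhatT2, if_pos (by omega), show 2 * n / 2 = n by omega]
    exact IsWick.tauEvenT2_eq hφ n
  · rw [tauhatT2, if_neg (by omega), show (2 * n + 1) / 2 = n by omega]
    exact IsWick.tauOddT2_eq hφ n
end

section
/- Let m_{i,j} : ℝ → ℝ and α_i : ℝ → ℝ (i, j ∈ ℕ) be differentiable functions of t satisfying m_{i,j} = m_{j,i}, m_{i,j}′ = m_{i+1,j} + m_{i,j+1}, α_i′ = α_{i+1}, and the rank one shift condition m_{i+1,j} + m_{i,j+1} = α_i·α_j for all i, j. Define τ_0 = 1, τ_n = det((m_{i,j})_{i,j=0}^{n−1}), and σ̃_n = det(M⁽ⁿ⁾), where M⁽ⁿ⁾ is the (n+1)×(n+1) matrix whose first n columns are (m_{i,j})_{i=0,…,n; j=0,…,n−1} and whose last column is (α_i)_{i=0,…,n}. Then for every n ≥ 0 and all t: τ_{n+1}′·τ_n − τ_{n+1}·τ_n′ = σ̃_n² (equivalently, in Hirota form, D_{t₁} τ_{n+1} · τ_n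 = σ̃_n·σ̃_n). -/
/-- `τ_n(t) = det((m_{i,j}(t))_{i,j=0}^{n−1})`; in particular `τ_0 = 1`. -/
noncomputable def tauDet (m : ℕ → ℕ → ℝ → ℝ) (n : ℕ) : ℝ → ℝ :=
  fun t => (Matrix.of fun i j : Fin n => m i j t).det

/-- `σ̃_n(t)`: the bordered determinant whose first `n` columns are `(m_{i,j})` for
`i = 0,…,n`, `j = 0,…,n−1`, and whose last column is `(α_0,…,α_n)`. -/
noncomputable def sigmaDet (m : ℕ → ℕ → ℝ → ℝ) (α : ℕ → ℝ → ℝ) (n : ℕ) : ℝ → ℝ :=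
  fun t => (Matrix.of fun i j : Fin (n + 1) =>
    if (j : ℕ) = n then α (i : ℕ) t else m (i : ℕ) (j : ℕ) t).det

namespace Matrix

variable {R : Type*} [CommRing R] {n : ℕ}

theorem adjugate_last_last (A : Matrix (Fin (n + 1)) (Fin (n + 1)) R) :
    A.adjugate (Fin.last n) (Fin.last n) = (A.submatrix Fin.castSucc Fin.castSucc).det := by
  simp [adjugate_fin_succ_eq_det_submatrix]

theorem adjugate_submatrix_castSucc_of_isRegular (A : Matrix (Fin (n + 1)) (Fin (n + 1)) R)
    (hA : IsRegular (A.submatrix Fin.castSucc Fin.castSucc).det) (i j : Fin n) :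
    (A.submatrix Fin.castSucc Fin.castSucc).det * A.adjugate i.castSucc j.castSucc =
      A.adjugate i.castSucc (Fin.last n) * A.adjugate (Fin.last n) j.castSucc +
        A.det * (A.submatrix Fin.castSucc Fin.castSucc).adjugate i j := by
  have hll := adjugate_last_last A
  set B := A.submatrix Fin.castSucc Fin.castSucc with hB
  set P := A.adjugate.submatrix Fin.castSucc Fin.castSucc with hP
  set w : Fin n → R := fun i => A.adjugate i.castSucc (Fin.last n) with hw
  set z : Fin n → R := fun j => A.adjugate (Fin.last n) j.castSucc with hz
  have key : (B.det • P - vecMulVec w z) * B = (B.det * A.det) • (1 : Matrix _ _ R) := by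
    ext k l
    have h1 := congrFun (congrFun (adjugate_mul A) k.castSucc) l.castSucc
    have h2 := congrFun (congrFun (adjugate_mul A) (Fin.last n)) l.castSucc
    rw [mul_apply, Fin.sum_univ_castSucc] at h1 h2
    rw [hll] at h2
    have h3 : ((B.det • P - vecMulVec w z) * B) k l =
        B.det * ∑ i : Fin n, A.adjugate k.castSucc i.castSucc * A i.castSucc l.castSucc -
          w k * ∑ i : Fin n, A.adjugate (Fin.last n) i.castSucc * A i.castSucc l.castSucc := by
      simp only [mul_apply, Finset.mul_sum, ← Finset.sum_sub_distrib]
      refine Finset.sum_congr rfl fun i _ => ?_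
      simp only [sub_apply, smul_apply, vecMulVec_apply, smul_eq_mul, hP, hB, hz, submatrix_apply]
      ring
    have h4 : (A.det • (1 : Matrix _ _ R)) (Fin.last n) l.castSucc = 0 := by
      simp [(Fin.castSucc_lt_last l).ne']
    have h5 : (A.det • (1 : Matrix _ _ R)) k.castSucc l.castSucc =
        A.det * (1 : Matrix _ _ R) k l := by
      simp [one_apply]
    rw [h4] at h2
    rw [h5] at h1
    rw [h3, smul_apply, smul_eq_mul]
    linear_combination B.det * h1 - w k * h2
  have key2 : B.det • (B.det • P - vecMulVec w z) = (B.det * A.det) • B.adjugate := by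
    have := congrArg (· * B.adjugate) key
    simpa [Matrix.mul_assoc, mul_adjugate] using this
  have h := congrFun (congrFun key2 i) j
  simp only [smul_apply, sub_apply, vecMulVec_apply, smul_eq_mul, mul_assoc] at h
  have h' := hA.left h
  simp only [hP, submatrix_apply] at h'
  linear_combination h'

/-- A form of Sylvester's determinant identity for the entries of the adjugate. -/
theorem adjugate_submatrix_castSucc (A : Matrix (Fin (n + 1)) (Fin (n + 1)) R) (i j : Fin n) :
    (A.submatrix Fin.castSucc Fin.castSucc).det * A.adjugate i.castSucc j.castSucc =
      A.adjugate i.castSucc (Fin.last n) * A.adjugate (Fin.last n) j.castSucc +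
        A.det * (A.submatrix Fin.castSucc Fin.castSucc).adjugate i j := by
  open Polynomial in
  let G : Matrix (Fin (n + 1)) (Fin (n + 1)) R[X] := (X : R[X]) • 1 + A.map C
  let f : R[X] →+* R := evalRingHom 0
  have hG : f.mapMatrix G = A := by
    ext
    simp [f, G]
  have hGs : f.mapMatrix (G.submatrix Fin.castSucc Fin.castSucc) =
      A.submatrix Fin.castSucc Fin.castSucc := by
    ext
    simp [f, G]
  have hsub : G.submatrix Fin.castSucc Fin.castSucc =
      (X : R[X]) • 1 + (A.submatrix Fin.castSucc Fin.castSucc).map C := by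
    ext k l
    simp [G, one_apply]
  have hreg : IsRegular (G.submatrix Fin.castSucc Fin.castSucc).det := by
    rw [hsub]
    exact Monic.isRegular (leadingCoeff_det_X_one_add_C _)
  have h := congrArg f (adjugate_submatrix_castSucc_of_isRegular G hreg i j)
  have hadj : ∀ k l, f (G.adjugate k l) = A.adjugate k l := fun k l => by
    rw [← hG, ← RingHom.map_adjugate]
    rfl
  have hadjs : ∀ k l, f ((G.submatrix Fin.castSucc Fin.castSucc).adjugate k l) =
      (A.submatrix Fin.castSucc Fin.castSucc).adjugate k l := fun k l => by
    rw [← hGs, ← RingHom.map_adjugate]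
    rfl
  simpa only [map_mul, map_add, RingHom.map_det, hadj, hadjs, hG, hGs] using h

theorem dotProduct_adjugate_mulVec_castSucc (A : Matrix (Fin (n + 1)) (Fin (n + 1)) R)
    (x y : Fin (n + 1) → R) :
    (A.submatrix Fin.castSucc Fin.castSucc).det * (x ⬝ᵥ A.adjugate *ᵥ y) =
      (x ᵥ* A.adjugate) (Fin.last n) * (A.adjugate *ᵥ y) (Fin.last n) +
        A.det * ((x ∘ Fin.castSucc) ⬝ᵥ
          (A.submatrix Fin.castSucc Fin.castSucc).adjugate *ᵥ (y ∘ Fin.castSucc)) := by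
  have hll := adjugate_last_last A
  have hs : ∑ i : Fin n, ∑ j : Fin n, x i.castSucc * ((A.submatrix Fin.castSucc Fin.castSucc).det *
        A.adjugate i.castSucc j.castSucc) * y j.castSucc =
      (∑ i : Fin n, x i.castSucc * A.adjugate i.castSucc (Fin.last n)) *
        (∑ j : Fin n, A.adjugate (Fin.last n) j.castSucc * y j.castSucc) +
      A.det * ∑ i : Fin n, x i.castSucc * ∑ j : Fin n,
        (A.submatrix Fin.castSucc Fin.castSucc).adjugate i j * y j.castSucc := by
    rw [Finset.sum_mul_sum]
    simp only [adjugate_submatrix_castSucc, Finset.mul_sum,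
      ← Finset.sum_add_distrib]
    refine Finset.sum_congr rfl fun i _ => Finset.sum_congr rfl fun j _ => ?_
    ring
  have hs' : ∑ i : Fin n, ∑ j : Fin n, x i.castSucc * ((A.submatrix Fin.castSucc Fin.castSucc).det *
        A.adjugate i.castSucc j.castSucc) * y j.castSucc =
      (A.submatrix Fin.castSucc Fin.castSucc).det * ∑ i : Fin n, x i.castSucc *
        ∑ j : Fin n, A.adjugate i.castSucc j.castSucc * y j.castSucc := by
    simp only [Finset.mul_sum]
    refine Finset.sum_congr rfl fun i _ => Finset.sum_congr rfl fun j _ => ?_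
    ring
  have hx : ∑ i : Fin n, x i.castSucc * (A.adjugate i.castSucc (Fin.last n) * y (Fin.last n)) =
      (∑ i : Fin n, x i.castSucc * A.adjugate i.castSucc (Fin.last n)) * y (Fin.last n) := by
    simp only [Finset.sum_mul, mul_assoc]
  simp only [dotProduct, mulVec, vecMul, Fin.sum_univ_castSucc, Function.comp_apply, hll, mul_add,
    Finset.sum_add_distrib] at hs ⊢
  rw [hx]
  linear_combination hs - hs'

theorem hasDerivAt_det {𝕜 ι : Type*} [NontriviallyNormedField 𝕜] [Fintype ι] [DecidableEq ι]
    {M : 𝕜 → Matrix ι ι 𝕜} {M' : Matrix ι ι 𝕜} {t : 𝕜}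
    (hM : ∀ i j, HasDerivAt (fun s => M s i j) (M' i j) t) :
    HasDerivAt (fun s => (M s).det) ((M t).adjugate * M').trace t := by
  have h : HasDerivAt (fun s => (M s).det) (∑ σ : Equiv.Perm ι, ((Equiv.Perm.sign σ : ℤ) : 𝕜) *
      ∑ j, (∏ i ∈ Finset.univ.erase j, M t (σ i) i) • M' (σ j) j) t := by
    simp only [det_apply']
    exact HasDerivAt.fun_sum fun σ _ =>
      (HasDerivAt.fun_finsetProd fun i _ => hM (σ i) i).const_mul _
  convert h using 1
  have hcol : ∀ j, ((M t).adjugate * M') j j = ((M t).updateCol j (M'.col j)).det := fun j => by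
    rw [← cramer_apply, cramer_eq_adjugate_mulVec]
    rfl
  simp only [trace, diag_apply, hcol, det_apply', Finset.mul_sum]
  rw [Finset.sum_comm]
  refine Finset.sum_congr rfl fun σ _ => Finset.sum_congr rfl fun j _ => ?_
  rw [← Finset.prod_erase_mul _ _ (Finset.mem_univ j), updateCol_self, smul_eq_mul]
  congr 2
  refine Finset.prod_congr rfl fun i hi => ?_
  rw [updateCol_ne (Finset.ne_of_mem_erase hi)]

end Matrix

open Matrix in
theorem deriv_tauDet {m : ℕ → ℕ → ℝ → ℝ} {α : ℕ → ℝ → ℝ}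
    (hm : ∀ i j t, HasDerivAt (m i j) (α i t * α j t) t) (n : ℕ) (t : ℝ) :
    deriv (tauDet m n) t = (fun i : Fin n => α i t) ⬝ᵥ
      (Matrix.of fun i j : Fin n => m i j t).adjugate *ᵥ (fun i : Fin n => α i t) := by
  have h := hasDerivAt_det (M := fun s => Matrix.of fun i j : Fin n => m i j s)
    (M' := vecMulVec (fun i : Fin n => α i t) (fun i : Fin n => α i t)) (t := t)
    fun i j => hm i j t
  rw [mul_vecMulVec, trace_vecMulVec, dotProduct_comm] at h
  exact h.deriv

theorem sigmaDet_eq (m : ℕ → ℕ → ℝ → ℝ) (α : ℕ → ℝ → ℝ) (n : ℕ) (t : ℝ) :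
    sigmaDet m α n t = ((Matrix.of fun i j : Fin (n + 1) => m i j t).adjugate.mulVec
      (fun i : Fin (n + 1) => α i t)) (Fin.last n) := by
  rw [← Matrix.cramer_eq_adjugate_mulVec, Matrix.cramer_apply, sigmaDet]
  congr 1
  ext i j
  simp [Matrix.updateCol_apply, Fin.ext_iff]

/-- first equation of the C-Toda lattice: for symmetric moments evolving by
`∂ₜ m_{i,j} = m_{i+1,j} + m_{i,j+1}` with the rank one shift condition
`m_{i+1,j} + m_{i,j+1} = α_i α_j`, `∂ₜ α_i = α_{i+1}`, one has
`τ_{n+1}′·τ_n − τ_{n+1}·τ_n′ = σ̃_n²` (Hirota form: `D τ_{n+1}·τ_n = σ̃_n·σ̃_n`). -/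
theorem stmt16 (m : ℕ → ℕ → ℝ → ℝ) (α : ℕ → ℝ → ℝ)
    (hsym : ∀ i j t, m i j t = m j i t)
    (hmdiff : ∀ i j, Differentiable ℝ (m i j))
    (hαdiff : ∀ i, Differentiable ℝ (α i))
    (hmder : ∀ i j t, deriv (m i j) t = m (i + 1) j t + m i (j + 1) t)
    (hαder : ∀ i t, deriv (α i) t = α (i + 1) t)
    (hrank1 : ∀ i j t, m (i + 1) j t + m i (j + 1) t = α i t * α j t) :
    ∀ n : ℕ, ∀ t : ℝ,
      deriv (tauDet m (n + 1)) t * tauDet m n t -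
          tauDet m (n + 1) t * deriv (tauDet m n) t =
        (sigmaDet m α n t) ^ 2 := by
  intro n t
  have hm : ∀ i j t, HasDerivAt (m i j) (α i t * α j t) t := fun i j t => by
    rw [← hrank1, ← hmder]
    exact (hmdiff i j t).hasDerivAt
  have hS : (Matrix.of fun i j : Fin (n + 1) => m i j t).IsSymm :=
    Matrix.IsSymm.ext fun i j => hsym j i t
  have h := Matrix.dotProduct_adjugate_mulVec_castSucc
    (Matrix.of fun i j : Fin (n + 1) => m i j t) (fun i => α i t) (fun i => α i t)
  rw [← Matrix.mulVec_transpose, hS.adjugate.eq, ← sigmaDet_eq, ← deriv_tauDet hm] at h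
  have h' : tauDet m n t * deriv (tauDet m (n + 1)) t =
      sigmaDet m α n t * sigmaDet m α n t + tauDet m (n + 1) t * deriv (tauDet m n) t := by
    rw [deriv_tauDet hm n]
    exact h
  linear_combination h'
end
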